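/- arXiv:2112.00070 — 2 statements merged into one kernel-verified Lean document; each statement's English description precedes it below -/
import Mathlib

section
/- Let G be a connected graph on n ≥ 2 vertices, and let k ≥ 4 and s ≥ 2 be integers. If G has no cycle of length at least k, then N_s(G) ≤ r·C(k-1, s) + C(t+1, s), where n-1 = r(k-2) + t with 0 ≤ t ≤ k-3. -/
namespace Kop
open Finset

variable {V : Type*} [DecidableEq V]

inductive HP (G : SimpleGraph V) : Finset V → V → V → Prop
  | single (u : V) : HP G {u} u u
  | cons {S : Finset V} {u w v : V} (hadj : G.Adj u w) (hu : u ∉ S) (h : HP G S w v) :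
      HP G (insert u S) u v

variable {G : SimpleGraph V}

theorem HP.left {S : Finset V} {u v : V} (h : HP G S u v) : u ∈ S := by
  cases h <;> simp

theorem HP.right {S : Finset V} {u v : V} (h : HP G S u v) : v ∈ S := by
  induction h <;> simp_all

theorem HP.snoc {S : Finset V} {u v w : V} (h : HP G S u v) (ha : G.Adj v w) (hw : w ∉ S) :
    HP G (insert w S) u w := by
  induction h with
  | single u =>
    have := HP.cons ha (S := {w}) (by simpa [eq_comm] using hw) (HP.single w)
    rwa [Finset.pair_comm] at this
  | cons hadj hu h ih =>
    simp only [Finset.mem_insert, not_or] at hw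
    have := HP.cons hadj (by simp [hu, Ne.symm hw.1]) (ih ha hw.2)
    rwa [Finset.insert_comm] at this

theorem HP.symm {S : Finset V} {u v : V} (h : HP G S u v) : HP G S v u := by
  induction h with
  | single u => exact HP.single u
  | cons hadj hu h ih => exact ih.snoc hadj.symm hu

theorem HP.trans {S T : Finset V} {u v w : V} (h : HP G S u v) (h' : HP G T v w)
    (hST : ∀ z ∈ S, z ∈ T → z = v) : HP G (S ∪ T) u w := by
  induction h with
  | single u =>
    rwa [Finset.union_eq_right.2 (by simpa using h'.left)]
  | @cons S u w' v hadj hu h ih =>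
    rw [Finset.insert_union]
    refine HP.cons hadj ?_ (ih h' fun z hz => hST z (by simp [hz]))
    intro hmem
    rcases Finset.mem_union.1 hmem with h1 | h1
    · exact hu h1
    · have := hST u (by simp) h1
      subst this
      exact hu h.right

theorem HP.append {S T : Finset V} {u v w z : V} (h : HP G S u v) (ha : G.Adj v w)
    (h' : HP G T w z) (hST : Disjoint S T) : HP G (S ∪ T) u z := by
  have h1 : v ∉ T := fun hv => (Finset.disjoint_left.1 hST h.right hv)
  have := h.trans (h'.cons ha h1) (by
    intro x hx hx'
    rcases Finset.mem_insert.1 hx' with rfl | hx'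
    · rfl
    · exact absurd hx' (Finset.disjoint_left.1 hST hx))
  rwa [Finset.union_insert, Finset.insert_eq_self.2 (by simp [h.right])] at this

theorem HP.final_part {S : Finset V} {u v z : V} (h : HP G S u v) (hz : z ∈ S) :
    ∃ S' ⊆ S, HP G S' z v ∧ (z ≠ u → u ∉ S') := by
  induction h with
  | single u =>
    simp only [Finset.mem_singleton] at hz
    subst hz
    exact ⟨_, Finset.Subset.refl _, HP.single _, by simp⟩
  | @cons S u w' v hadj hu h ih =>
    by_cases hzu : z = u
    · subst hzu
      exact ⟨_, Finset.Subset.refl _, HP.cons hadj hu h, by simp⟩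
    · obtain ⟨S', h1, h2, h3⟩ := ih (by simpa [hzu] using hz)
      exact ⟨S', h1.trans (Finset.subset_insert _ _), h2, fun _ hh => hu (h1 hh)⟩

theorem HP.initial_part {S : Finset V} {u v z : V} (h : HP G S u v) (hz : z ∈ S) :
    ∃ S' ⊆ S, HP G S' u z ∧ (z ≠ v → v ∉ S') := by
  obtain ⟨S', h1, h2, h3⟩ := h.symm.final_part hz
  exact ⟨S', h1, h2.symm, h3⟩

theorem HP.eq_single {S : Finset V} {u : V} (h : HP G S u u) : S = {u} := by
  cases h with
  | single => rfl
  | cons hadj hu h => exact absurd h.right hu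

theorem HP.uncons {S : Finset V} {u v : V} (h : HP G S u v) (huv : u ≠ v) :
    ∃ w T, S = insert u T ∧ u ∉ T ∧ G.Adj u w ∧ HP G T w v := by
  cases h with
  | single => exact absurd rfl huv
  | cons hadj hu h => exact ⟨_, _, rfl, hu, hadj, h⟩

theorem HP.map {W : Type*} [DecidableEq W] {H : SimpleGraph W} (f : V ↪ W)
    (hf : ∀ a b, G.Adj a b → H.Adj (f a) (f b))
    {S : Finset V} {u v : V} (h : HP G S u v) : HP H (S.map f) (f u) (f v) := by
  induction h with
  | single u => simpa using HP.single (f u)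
  | cons hadj hu h ih =>
    rw [Finset.map_insert]
    exact HP.cons (hf _ _ hadj) (by simpa using hu) ih

theorem HP.index {S : Finset V} {u v : V} (h : HP G S u v) :
    ∃ (m : ℕ) (p : ℕ → V), p 0 = u ∧ p m = v ∧ S.card = m + 1 ∧
      (∀ i ≤ m, ∀ j ≤ m, p i = p j → i = j) ∧ (∀ i < m, G.Adj (p i) (p (i + 1))) ∧
      S = (Finset.range (m + 1)).image p := by
  induction h with
  | single u =>
    exact ⟨0, fun _ => u, rfl, rfl, by simp, by omega, by omega, by simp⟩
  | @cons S u w v hadj hu h ih =>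
    obtain ⟨m, p, h0, hm, hc, hinj, ha, hS⟩ := ih
    have hpS : ∀ i ≤ m, p i ∈ S := by
      intro i hi
      rw [hS]
      exact Finset.mem_image_of_mem _ (by simp; omega)
    refine ⟨m + 1, fun i => Nat.casesOn i u p, rfl, hm, by simp [hu, hc], ?_, ?_, ?_⟩
    · rintro (_ | i) hi (_ | j) hj hij
      · rfl
      · exact absurd (show u = p j from hij) (fun e => hu (e ▸ hpS j (by omega)))
      · exact absurd (show p i = u from hij) (fun e => hu (e ▸ hpS i (by omega)))
      · rw [hinj i (by omega) j (by omega) hij]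
    · rintro (_ | i) hi
      · simpa [h0] using hadj
      · exact ha i (by omega)
    · rw [hS, Finset.range_add_one' (n := m + 1)]
      simp [Finset.image_insert, Finset.map_eq_image, Finset.image_image, Function.comp_def]
      rfl

theorem HP.seg (p : ℕ → V) (m : ℕ) (hinj : ∀ i ≤ m, ∀ j ≤ m, p i = p j → i = j)
    (ha : ∀ i < m, G.Adj (p i) (p (i + 1))) (i : ℕ) :
    ∀ j, i ≤ j → j ≤ m → HP G ((Finset.Icc i j).image p) (p i) (p j) := by
  intro j hij
  induction j, hij using Nat.le_induction with
  | base => intro _; simpa using HP.single (p i)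
  | succ j hij ih =>
    intro hj
    have := (ih (by omega)).snoc (ha j (by omega)) (w := p (j + 1)) (by
      simp only [Finset.mem_image, Finset.mem_Icc, not_exists, not_and]
      intro x hx he
      have := hinj x (by omega) (j + 1) hj he
      omega)
    rw [← Finset.image_insert] at this
    convert this using 2
    ext x; simp; omega

theorem HP.exists_cycle {S : Finset V} {u v : V} (h : HP G S u v) (hadj : G.Adj u v)
    (h3 : 3 ≤ S.card) : ∃ w : G.Walk u u, w.IsCycle ∧ w.length = S.card := by
  have key : ∀ {S : Finset V} {u v : V}, HP G S u v →
      ∃ w : G.Walk u v, w.IsPath ∧ w.length + 1 = S.card ∧ ∀ x, x ∈ w.support ↔ x ∈ S := by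
    intro S u v h
    induction h with
    | single u => exact ⟨SimpleGraph.Walk.nil, by simp, by simp, by simp⟩
    | cons hadj hu h ih =>
      obtain ⟨w, hw, hl, hs⟩ := ih
      refine ⟨SimpleGraph.Walk.cons hadj w, ?_, ?_, ?_⟩
      · rw [SimpleGraph.Walk.cons_isPath_iff]; exact ⟨hw, by rwa [hs]⟩
      · simp [hu, hl]
      · intro x; simp [hs]
  obtain ⟨w, T, rfl, huT, ha, hT⟩ := h.uncons hadj.ne
  obtain ⟨q, hq, hl, hs⟩ := key (hT.symm)
  -- q : v -> w, path avoiding u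
  rw [Finset.card_insert_of_notMem huT] at h3 ⊢
  have hqu : u ∉ q.support := by rwa [hs]
  have hvw : v ≠ w := by
    rintro rfl
    have := hT.eq_single
    simp [this] at h3
  refine ⟨SimpleGraph.Walk.cons hadj (q.concat ha.symm), ?_, ?_⟩
  · rw [SimpleGraph.Walk.cons_isCycle_iff]
    refine ⟨hq.concat hqu ha.symm, ?_⟩
    intro hmem
    rw [SimpleGraph.Walk.edges_concat, List.concat_eq_append, List.mem_append] at hmem
    rcases hmem with hmem | hmem
    · exact hqu (q.fst_mem_support_of_mem_edges hmem)
    · have := hadj.ne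
      simp at hmem
      grind
  · simp; omega

/-- no long cycles -/
def NoLong (G : SimpleGraph V) (k : ℕ) : Prop :=
  ∀ S u v, HP G S u v → G.Adj u v → S.card < k

/-- no separation of order at most one -/
def NoSep (G : SimpleGraph V) : Prop :=
  ∀ (b : V) (C : Set V), C.Nonempty → b ∉ C → (∃ y, y ∉ C ∧ y ≠ b) →
    ∃ c ∈ C, ∃ d, d ∉ C ∧ d ≠ b ∧ G.Adj c d

theorem ear (h2 : NoSep G) (b : V) (X Y : Finset V) (hX : X.Nonempty) (hY : Y.Nonempty)
    (hbX : b ∉ X) (hbY : b ∉ Y) :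
    ∃ E x y, HP G E x y ∧ b ∉ E ∧ x ∈ X ∧ y ∈ Y ∧ (∀ z ∈ E, z ∈ X → z = x) ∧
      (∀ z ∈ E, z ∈ Y → z = y) := by
  have hex : ∃ N E x y, HP G E x y ∧ b ∉ E ∧ x ∈ X ∧ y ∈ Y ∧ E.card = N := by
    by_contra hcon
    push Not at hcon
    let C : Set V := {c | ∃ E x, HP G E x c ∧ b ∉ E ∧ x ∈ X}
    obtain ⟨x0, hx0⟩ := hX
    obtain ⟨y0, hy0⟩ := hY
    have hbC : b ∉ C := by
      rintro ⟨E, x, hE, hb, -⟩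
      exact hb hE.right
    obtain ⟨c, ⟨E, x, hE, hb, hx⟩, d, hdC, hdb, hcd⟩ := h2 b C
      ⟨x0, {x0}, x0, HP.single x0, by
        simp only [Finset.mem_singleton]; rintro rfl; exact hbX hx0, hx0⟩ hbC
      ⟨y0, by
        rintro ⟨E, x, hE, hb, hx⟩
        exact hcon _ E x y0 hE hb hx hy0 rfl, by rintro rfl; exact hbY hy0⟩
    apply hdC
    by_cases hdE : d ∈ E
    · obtain ⟨S', h1, h3, -⟩ := hE.initial_part hdE
      exact ⟨S', x, h3, fun h => hb (h1 h), hx⟩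
    · exact ⟨insert d E, x, hE.snoc hcd hdE, by simp [hb, Ne.symm hdb], hx⟩
  classical
  obtain ⟨E, x, y, hE, hb, hx, hy, hN⟩ := Nat.find_spec hex
  have hmin := fun N (hN : N < Nat.find hex) => Nat.find_min hex hN
  refine ⟨E, x, y, hE, hb, hx, hy, ?_, ?_⟩
  · intro z hz hzX
    by_contra hne
    obtain ⟨S', h1, h3, h4⟩ := hE.final_part hz
    refine hmin S'.card ?_ ⟨S', z, y, h3, fun h => hb (h1 h), hzX, hy, rfl⟩
    rw [← hN]
    exact Finset.card_lt_card ⟨h1, fun h => h4 hne (h hE.left)⟩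
  · intro z hz hzY
    by_contra hne
    obtain ⟨S', h1, h3, h4⟩ := hE.initial_part hz
    refine hmin S'.card ?_ ⟨S', x, z, h3, fun h => hb (h1 h), hx, hzY, rfl⟩
    rw [← hN]
    exact Finset.card_lt_card ⟨h1, fun h => h4 hne (h hE.right)⟩

theorem menger (h2 : NoSep G) {Q : Finset V} {a b : V} (hQ : HP G Q a b) :
    ∀ (A B : Finset V), a ∈ A → b ∈ B → (∀ z ∈ Q, z ∈ A → z = a) → (∀ z ∈ Q, z ∈ B → z = b) →
      (∀ z ∈ A, z ∈ B → z = a ∧ z = b) → (∃ a' ∈ A, a' ≠ a) → (∃ b' ∈ B, b' ≠ b) →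
      ∃ R R' α β β', HP G R a β ∧ HP G R' α β' ∧ Disjoint R R' ∧ α ∈ A ∧ β ∈ B ∧ β' ∈ B ∧
        (∀ z ∈ R, z ∈ A → z = a) ∧ (∀ z ∈ R', z ∈ A → z = α) ∧
        (∀ z ∈ R, z ∈ B → z = β) ∧ (∀ z ∈ R', z ∈ B → z = β') ∧ (β = b ∨ β' = b) := by
  induction hQ with
  | single u =>
    intro A B haA hbB hQA hQB hAB ⟨a', ha', haa'⟩ ⟨b', hb', hbb'⟩
    obtain ⟨E, x, y, hE, hb, hx, hy, hEx, hEy⟩ := ear h2 u (A.erase u) (B.erase u)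
      ⟨a', by simp [*]⟩ ⟨b', by simp [*]⟩ (by simp) (by simp)
    refine ⟨{u}, E, x, u, y, HP.single u, hE, by simpa using hb, ?_, hbB, ?_, by simp, ?_, by simp,
      ?_, Or.inl rfl⟩
    · simp at hx; exact hx.2
    · simp at hy; exact hy.2
    · intro z hz hzA
      exact hEx z hz (by simp [hzA]; rintro rfl; exact hb hz)
    · intro z hz hzA
      exact hEy z hz (by simp [hzA]; rintro rfl; exact hb hz)
  | @cons Q a w b hadj haQ hQ ih =>
    intro A B haA hbB hQA hQB hAB ⟨a', ha', haa'⟩ ⟨b', hb', hbb'⟩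
    have hab : a ≠ b := by rintro rfl; exact haQ hQ.right
    have haw : a ≠ w := hadj.ne
    have haB : a ∉ B := fun h => hab (hQB a (by simp) h)
    have hwA : w ∉ A := fun h => haw (hQA w (by simp [hQ.left]) h).symm
    obtain ⟨R, R', α, β, β', hR, hR', hd, hα, hβ, hβ', hRA, hRA', hRB, hRB', hend⟩ :=
      ih (insert w A) B (by simp) hbB
        (by
          intro z hz hzA
          rcases Finset.mem_insert.1 hzA with h | h
          · exact h
          · have := hQA z (by simp [hz]) h
            subst this; exact absurd hz haQ)
        (fun z hz => hQB z (by simp [hz]))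
        (by
          intro z hz hzB
          rcases Finset.mem_insert.1 hz with h | h
          · subst h; exact ⟨rfl, hQB z (by simp [hQ.left]) hzB⟩
          · obtain ⟨h1, h2⟩ := hAB z h hzB
            exact absurd (h1.symm.trans h2) hab)
        ⟨a, by simp [haA], haw⟩ ⟨b', hb', hbb'⟩
    have hwR : w ∈ R := hR.left
    have hdis : ∀ z ∈ R, z ∉ R' := fun z hz => Finset.disjoint_left.1 hd hz
    have hαw : α ≠ w := by rintro rfl; exact hdis _ hwR hR'.left
    have hαA : α ∈ A := by simpa [hαw] using hα
    have hRnA : ∀ z ∈ R, z ∉ A := by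
      intro z hz hzA
      have := hRA z hz (by simp [hzA])
      subst this; exact hwA hzA
    have haR : a ∉ R := fun h => hRnA a h haA
    have hRA'2 : ∀ z ∈ R', z ∈ A → z = α := fun z hz hzA => hRA' z hz (by simp [hzA])
    by_cases hαa : α = a
    · subst hαa
      -- ear avoiding a
      obtain ⟨E, x, y, hE, haE, hx, hy, hEx, hEy⟩ := ear h2 α (A.erase α) ((R ∪ R' ∪ B).erase α)
        ⟨a', by simp [*]⟩ ⟨w, by simp [*]; exact fun h => haw h.symm⟩ (by simp) (by simp)
      have hxA : x ∈ A := (Finset.mem_erase.1 hx).2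
      have hxα : x ≠ α := (Finset.mem_erase.1 hx).1
      have hyα : y ≠ α := (Finset.mem_erase.1 hy).1
      have hEne : ∀ z ∈ E, z ≠ α := by rintro z hz rfl; exact haE hz
      have hEA : ∀ z ∈ E, z ∈ A → z = x := fun z hz hzA =>
        hEx z hz (by simp [hzA, hEne z hz])
      have hER : ∀ z ∈ E, z ∈ R → z = y := fun z hz hzA =>
        hEy z hz (by simp [hzA, hEne z hz])
      have hER' : ∀ z ∈ E, z ∈ R' → z = y := fun z hz hzA =>
        hEy z hz (by simp [hzA, hEne z hz])
      have hEB : ∀ z ∈ E, z ∈ B → z = y := fun z hz hzA =>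
        hEy z hz (by simp [hzA, hEne z hz])
      have hyE := hE.right
      by_cases hyR : y ∈ R
      · obtain ⟨T, hTR, hT, -⟩ := hR.final_part hyR
        have hET := hE.trans hT (fun z hz hzT => hER z hz (hTR hzT))
        refine ⟨R', E ∪ T, x, β', β, hR', hET, ?_, hxA, hβ', hβ, hRA'2, ?_, hRB', ?_, hend.symm⟩
        · rw [Finset.disjoint_left]; grind
        · grind
        · grind
      · by_cases hyR' : y ∈ R'
        · obtain ⟨T, hTR, hT, hTα⟩ := hR'.final_part hyR'
          have hTα' := hTα hyα
          have hET := hE.trans hT (fun z hz hzT => hER' z hz (hTR hzT))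
          refine ⟨insert α R, E ∪ T, x, β, β', hR.cons hadj haR, hET, ?_, hxA, hβ, hβ', ?_, ?_,
            ?_, ?_, hend⟩
          · rw [Finset.disjoint_left]; grind
          · grind
          · grind
          · grind
          · grind
        · have hyB : y ∈ B := by
            have := (Finset.mem_erase.1 hy).2
            simp only [Finset.mem_union] at this
            tauto
          rcases hend with h | h
          · refine ⟨insert α R, E, x, β, y, hR.cons hadj haR, hE, ?_, hxA, hβ, hyB, ?_, hEA,
              ?_, hEB, Or.inl h⟩
            · rw [Finset.disjoint_left]; grind
            · grind
            · grind
          · refine ⟨R', E, x, β', y, hR', hE, ?_, hxA, hβ', hyB, hRA'2, hEA,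
              hRB', hEB, Or.inl h⟩
            rw [Finset.disjoint_left]; grind
    · refine ⟨insert a R, R', α, β, β', hR.cons hadj haR, hR', ?_, hαA, hβ, hβ', ?_, hRA'2,
        ?_, hRB', hend⟩
      · rw [Finset.disjoint_left]; grind
      · grind
      · grind

theorem close_cycle {k : ℕ} (hno : NoLong G k) {S T : Finset V} {u v : V} (hS : HP G S u v)
    (hT : HP G T u v) (huv : u ≠ v) (hST : ∀ z ∈ S, z ∈ T → z = u ∨ z = v) : S.card < k := by
  obtain ⟨w, T', rfl, huT, ha, hT'⟩ := hT.uncons huv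
  have h1 := hS.trans hT'.symm (by
    intro z hz hzT
    rcases hST z hz (by simp [hzT]) with h | h
    · subst h; exact absurd hzT huT
    · exact h)
  exact lt_of_le_of_lt (Finset.card_le_card Finset.subset_union_left) (hno _ _ _ h1 ha)

/-- the end segment lemma -/
theorem end_seg (p : ℕ → V) (m : ℕ) (hinj : ∀ i ≤ m, ∀ j ≤ m, p i = p j → i = j)
    (ha : ∀ i < m, G.Adj (p i) (p (i + 1))) (a : ℕ) (ham : a ≤ m) (hadj : G.Adj (p 0) (p a))
    (hmax : ∀ l ≤ m, G.Adj (p 0) (p l) → l ≤ a) (i : ℕ) (hi : i < a) :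
    ∃ T, HP G T (p i) (p a) ∧ T ⊆ (Finset.Icc 0 a).image p ∧ p 0 ∈ T ∧
      ∀ l ≤ m, G.Adj (p 0) (p l) → p l ∈ T := by
  classical
  have hex : ∃ l, i < l ∧ G.Adj (p 0) (p l) := ⟨a, hi, hadj⟩
  obtain ⟨l, ⟨hl1, hl2⟩, hl3⟩ : ∃ l, (i < l ∧ G.Adj (p 0) (p l)) ∧
      ∀ l', i < l' → G.Adj (p 0) (p l') → l ≤ l' :=
    ⟨Nat.find hex, Nat.find_spec hex, fun l' h1 h2 => Nat.find_min' hex ⟨h1, h2⟩⟩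
  have hla : l ≤ a := hl3 a hi hadj
  have h1 := (HP.seg p m hinj ha 0 i (by omega) (by omega)).symm
  have h2 := HP.seg p m hinj ha l a hla ham
  refine ⟨_, h1.append hl2 h2 ?_, ?_, ?_, ?_⟩
  · rw [Finset.disjoint_left]
    simp only [Finset.mem_image, Finset.mem_Icc]
    rintro _ ⟨x, hx, rfl⟩ ⟨y, hy, he⟩
    have := hinj y (by omega) x (by omega) he
    omega
  · rw [← Finset.image_union]
    apply Finset.image_subset_image
    intro x; simp; omega
  · rw [← Finset.image_union]
    exact Finset.mem_image_of_mem _ (by simp)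
  · intro x hx hxa
    rw [← Finset.image_union]
    refine Finset.mem_image_of_mem _ ?_
    have := hmax x hx hxa
    have := hl3 x
    simp
    by_cases h : i < x
    · have := this h hxa; omega
    · omega

open Classical in
theorem kop [Fintype V] {k : ℕ} (h2 : NoSep G) (hno : NoLong G k) (hk : 4 ≤ k) {S : Finset V} {x y : V}
    (hP : HP G S x y) (hS : k ≤ S.card) :
    (S.filter (G.Adj x)).card + (S.filter (G.Adj y)).card < k := by
  obtain ⟨m, p, h0, hm, hc, hinj, ha, rfl⟩ := hP.index
  subst h0 hm
  have hm3 : 3 ≤ m := by omega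
  let Nx := (Finset.range (m + 1)).filter (fun l => G.Adj (p 0) (p l))
  let Ny := (Finset.range (m + 1)).filter (fun l => G.Adj (p m) (p l))
  have hNx : (((Finset.range (m + 1)).image p).filter (G.Adj (p 0))).card ≤ Nx.card := by
    rw [Finset.filter_image]; exact Finset.card_image_le
  have hNy : (((Finset.range (m + 1)).image p).filter (G.Adj (p m))).card ≤ Ny.card := by
    rw [Finset.filter_image]; exact Finset.card_image_le
  have memx : ∀ l, l ∈ Nx ↔ l ≤ m ∧ G.Adj (p 0) (p l) := by intro l; simp [Nx]
  have memy : ∀ l, l ∈ Ny ↔ l ≤ m ∧ G.Adj (p m) (p l) := by intro l; simp [Ny]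
  have hx0 : ∀ l ∈ Nx, 1 ≤ l := by
    intro l hl
    rcases Nat.eq_zero_or_pos l with rfl | h
    · exact absurd ((memx 0).1 hl).2 (G.irrefl)
    · exact h
  have hym : ∀ l ∈ Ny, l < m := by
    intro l hl
    have h1 := (memy l).1 hl
    rcases Nat.lt_or_ge l m with h | h
    · exact h
    · have : l = m := by omega
      subst this; exact absurd h1.2 G.irrefl
  by_cases hcross : ∃ g i j, i ∈ Ny ∧ j ∈ Nx ∧ i < j ∧ j - i = g
  · obtain ⟨i, j, hi, hj, hij, hg⟩ := Nat.find_spec hcross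
    have hmin : ∀ i' j', i' ∈ Ny → j' ∈ Nx → i' < j' → j - i ≤ j' - i' := by
      intro i' j' h1 h2 h3
      rw [hg]
      exact Nat.find_min' hcross ⟨i', j', h1, h2, h3, rfl⟩
    have hjm := ((memx j).1 hj).1
    have hd : Disjoint ((Finset.Icc 0 i).image p) ((Finset.Icc j m).image p) := by
      rw [Finset.disjoint_left]
      simp only [Finset.mem_image, Finset.mem_Icc]
      rintro _ ⟨x, hx, rfl⟩ ⟨y, hy, he⟩
      have := hinj y (by omega) x (by omega) he
      omega
    have hcyc := (HP.seg p m hinj ha 0 i (by omega) (by omega)).append ((memy i).1 hi).2.symm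
      (HP.seg p m hinj ha j m hjm le_rfl).symm hd
    have hlt := hno _ _ _ hcyc ((memx j).1 hj).2
    rw [Finset.card_union_of_disjoint hd, Finset.card_image_of_injOn, Finset.card_image_of_injOn,
      Nat.card_Icc, Nat.card_Icc] at hlt
    rotate_left
    · intro x hx y hy; simp at hx hy; exact hinj _ (by omega) _ (by omega)
    · intro x hx y hy; simp at hx hy; exact hinj _ (by omega) _ (by omega)
    have hgap : i + 2 ≤ j := by omega
    -- count
    have hcount : Nx.card + Ny.card ≤ (Finset.range (i + 1) ∪ Finset.Ico (j - 1) m).card := by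
      have e1 : Nx.card = (Nx.image (fun l => l - 1)).card := by
        rw [Finset.card_image_of_injOn]
        intro a ha b hb hab
        have := hx0 a ha
        have := hx0 b hb
        simp only at hab
        omega
      rw [e1, ← Finset.card_union_of_disjoint]
      · apply Finset.card_le_card
        intro l hl
        simp only [Finset.mem_union, Finset.mem_image, Finset.mem_range, Finset.mem_Ico] at hl ⊢
        rcases hl with ⟨l', hl', rfl⟩ | hl
        · have h1 := hx0 l' hl'
          have h2 := ((memx l').1 hl').1
          have h3 := hmin i l' hi hl'
          omega
        · have h1 := hym l hl
          have h3 := hmin l j hl hj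
          omega
      · rw [Finset.disjoint_left]
        simp only [Finset.mem_image]
        rintro _ ⟨l', hl', rfl⟩ hl
        have h1 := hx0 l' hl'
        have h3 := hmin _ _ hl hl' (by omega)
        omega
    have hcard : (Finset.range (i + 1) ∪ Finset.Ico (j - 1) m).card ≤ (i + 1) + (m - (j - 1)) := by
      refine (Finset.card_union_le _ _).trans ?_
      simp
    omega
  · have hnc : ∀ i ∈ Ny, ∀ j ∈ Nx, j ≤ i := by
      intro i hi j hj
      by_contra h
      exact hcross ⟨_, i, j, hi, hj, by omega, rfl⟩
    have h1x : 1 ∈ Nx := (memx 1).2 ⟨by omega, ha 0 (by omega)⟩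
    have h1y : m - 1 ∈ Ny := (memy _).2 ⟨by omega, by
      have := ha (m - 1) (by omega)
      rw [Nat.sub_add_cancel (by omega)] at this
      exact this.symm⟩
    obtain ⟨a, haN, hamax⟩ := Finset.exists_max_image Nx id ⟨1, h1x⟩
    obtain ⟨b, hbN, hbmin⟩ := Finset.exists_min_image Ny id ⟨m - 1, h1y⟩
    simp only [id] at hamax hbmin
    have hab : a ≤ b := hnc b hbN a haN
    have ha1 := hx0 a haN
    have hbm := hym b hbN
    let A := (Finset.Icc 0 a).image p
    let B := (Finset.Icc b m).image p
    have memA : ∀ i ≤ m, (p i ∈ A ↔ i ≤ a) := by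
      intro i hi
      simp only [A, Finset.mem_image, Finset.mem_Icc]
      constructor
      · rintro ⟨j, hj, he⟩
        have := hinj _ (by omega) _ hi he
        omega
      · intro h; exact ⟨i, by omega, rfl⟩
    have memB : ∀ i ≤ m, (p i ∈ B ↔ b ≤ i) := by
      intro i hi
      simp only [B, Finset.mem_image, Finset.mem_Icc]
      constructor
      · rintro ⟨j, hj, he⟩
        have := hinj _ (by omega) _ hi he
        omega
      · intro h; exact ⟨i, by omega, rfl⟩
    have exA : ∀ z ∈ A, ∃ i ≤ a, p i = z := by
      intro z hz
      simp only [A, Finset.mem_image, Finset.mem_Icc] at hz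
      obtain ⟨i, hi, rfl⟩ := hz; exact ⟨i, by omega, rfl⟩
    have exB : ∀ z ∈ B, ∃ i, b ≤ i ∧ i ≤ m ∧ p i = z := by
      intro z hz
      simp only [B, Finset.mem_image, Finset.mem_Icc] at hz
      obtain ⟨i, hi, rfl⟩ := hz; exact ⟨i, by omega, by omega, rfl⟩
    have hABab : ∀ z ∈ A, z ∈ B → z = p a ∧ z = p b := by
      intro z hzA hzB
      obtain ⟨i, hi, rfl⟩ := exA z hzA
      have := (memB i (by omega)).1 hzB
      have h1 : i = a := by omega
      have h2 : i = b := by omega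
      exact ⟨by rw [h1], by rw [h2]⟩
    obtain ⟨R, R', α, β, β', hR, hR', hd, hα, hβ, hβ', hRA, hRA', hRB, hRB', hend⟩ :=
      menger h2 (HP.seg p m hinj ha a b hab (by omega)) A B
        ((memA a (by omega)).2 le_rfl) ((memB b (by omega)).2 le_rfl)
        (by
          intro z hz hzA
          simp only [Finset.mem_image, Finset.mem_Icc] at hz
          obtain ⟨i, hi, rfl⟩ := hz
          have := (memA i (by omega)).1 hzA
          rw [show i = a by omega])
        (by
          intro z hz hzA
          simp only [Finset.mem_image, Finset.mem_Icc] at hz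
          obtain ⟨i, hi, rfl⟩ := hz
          have := (memB i (by omega)).1 hzA
          rw [show i = b by omega])
        hABab
        ⟨p 0, (memA 0 (by omega)).2 (by omega), fun h => by
          have := hinj _ (by omega) _ (by omega) h; omega⟩
        ⟨p m, (memB m (by omega)).2 (by omega), fun h => by
          have := hinj _ (by omega) _ (by omega) h; omega⟩
    have hdis : ∀ z ∈ R, z ∉ R' := fun z hz => Finset.disjoint_left.1 hd hz
    obtain ⟨i, hia, rfl⟩ := exA α hα
    have hia' : i < a := by
      rcases Nat.lt_or_ge i a with h | h
      · exact h
      · have : i = a := by omega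
        subst this
        exact absurd hR'.left (hdis _ hR.left)
    obtain ⟨TA, hTA, hTAsub, hTA0, hTAn⟩ := end_seg p m hinj ha a (by omega) ((memx a).1 haN).2
      (fun l hl hla => hamax l ((memx l).2 ⟨hl, hla⟩)) i hia'
    -- the other end
    have hBend : ∀ j, b < j → j ≤ m → ∃ T, HP G T (p j) (p b) ∧ T ⊆ B ∧ p m ∈ T ∧
        ∀ l ≤ m, G.Adj (p m) (p l) → p l ∈ T := by
      intro j hbj hjm
      obtain ⟨T, hT, hTs, hT0, hTn⟩ := end_seg (G := G) (fun i => p (m - i)) m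
        (by
          intro i hi j hj he
          have := hinj _ (by omega) _ (by omega) he
          omega)
        (by
          intro i hi
          have := ha (m - (i + 1)) (by omega)
          rw [show m - (i + 1) + 1 = m - i by omega] at this
          exact this.symm)
        (m - b) (by omega) (by
          simp only [Nat.sub_zero]
          rw [show m - (m - b) = b by omega]
          exact ((memy b).1 hbN).2)
        (by
          intro l hl hla
          simp only [Nat.sub_zero] at hla
          have := hbmin (m - l) ((memy _).2 ⟨by omega, hla⟩)
          omega)
        (m - j) (by omega)
      simp only [Nat.sub_zero] at hT0 hTn hT
      rw [show m - (m - j) = j by omega, show m - (m - b) = b by omega] at hT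
      refine ⟨T, hT, ?_, hT0, ?_⟩
      · intro z hz
        have := hTs hz
        simp only [Finset.mem_image, Finset.mem_Icc] at this
        obtain ⟨l, hl, rfl⟩ := this
        exact (memB _ (by omega)).2 (by omega)
      · intro l hl hla
        have := hTn (m - l) (by omega)
        rw [show m - (m - l) = l by omega] at this
        exact this hla
    have hββ' : β ≠ β' := by rintro rfl; exact hdis _ hR.right hR'.right
    obtain ⟨TB, hTB, hTBsub, hTB0, hTBn⟩ : ∃ T, HP G T β β' ∧ T ⊆ B ∧ p m ∈ T ∧
        ∀ l ≤ m, G.Adj (p m) (p l) → p l ∈ T := by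
      rcases hend with h | h
      · obtain ⟨j, hj1, hj2, rfl⟩ := exB β' hβ'
        have : b ≠ j := by rintro rfl; exact hββ' h
        obtain ⟨T, h1, h2, h3, h4⟩ := hBend j (by omega) hj2
        exact ⟨T, by rw [h]; exact h1.symm, h2, h3, h4⟩
      · obtain ⟨j, hj1, hj2, rfl⟩ := exB β hβ
        have : b ≠ j := by rintro rfl; exact hββ' h.symm
        obtain ⟨T, h1, h2, h3, h4⟩ := hBend j (by omega) hj2
        exact ⟨T, by rw [h]; exact h1, h2, h3, h4⟩
    have hTAsub' : TA ⊆ A := hTAsub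
    have c1 := hTA.trans hR (fun z hz hzR => hRA z hzR (hTAsub' hz))
    have haR := hR.left
    have c2 := c1.trans hTB (by
      intro z hz hzB
      rcases Finset.mem_union.1 hz with h | h
      · have := (hABab z (hTAsub' h) (hTBsub hzB)).1
        subst this
        exact hRB _ haR (hTBsub hzB)
      · exact hRB z h (hTBsub hzB))
    have hne : p i ≠ β' := by
      intro h
      have := (hABab (p i) hα (h ▸ hβ')).1
      have := hinj _ (by omega) _ (by omega) this
      omega
    have hlt := close_cycle hno c2 hR' hne (by
      intro z hz hzR'
      simp only [Finset.mem_union] at hz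
      rcases hz with (h | h) | h
      · exact Or.inl (hRA' z hzR' (hTAsub' h))
      · exact absurd hzR' (hdis z h)
      · exact Or.inr (hRB' z hzR' (hTBsub h)))
    have hI : (TA ∩ TB).card ≤ 1 := by
      rw [Finset.card_le_one]
      intro u hu v hv
      rw [Finset.mem_inter] at hu hv
      rw [(hABab u (hTAsub' hu.1) (hTBsub hu.2)).1, (hABab v (hTAsub' hv.1) (hTBsub hv.2)).1]
    have hsub : (TA ∪ TB).card ≤ (TA ∪ R ∪ TB).card := by
      apply Finset.card_le_card
      intro z; simp only [Finset.mem_union]; tauto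
    have hIE := Finset.card_union_add_card_inter TA TB
    have hbA : (insert (p 0) (Nx.image p)).card ≤ TA.card := by
      apply Finset.card_le_card
      intro z hz
      simp only [Finset.mem_insert, Finset.mem_image] at hz
      rcases hz with rfl | ⟨l, hl, rfl⟩
      · exact hTA0
      · exact hTAn l ((memx l).1 hl).1 ((memx l).1 hl).2
    have hbB : (insert (p m) (Ny.image p)).card ≤ TB.card := by
      apply Finset.card_le_card
      intro z hz
      simp only [Finset.mem_insert, Finset.mem_image] at hz
      rcases hz with rfl | ⟨l, hl, rfl⟩
      · exact hTB0
      · exact hTBn l ((memy l).1 hl).1 ((memy l).1 hl).2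
    have hcA : (Nx.image p).card = Nx.card := Finset.card_image_of_injOn (by
      intro u hu v hv
      exact hinj _ ((memx u).1 hu).1 _ ((memx v).1 hv).1)
    have hcB : (Ny.image p).card = Ny.card := Finset.card_image_of_injOn (by
      intro u hu v hv
      exact hinj _ ((memy u).1 hu).1 _ ((memy v).1 hv).1)
    rw [Finset.card_insert_of_notMem, hcA] at hbA
    rotate_left
    · simp only [Finset.mem_image, not_exists, not_and]
      intro l hl he
      have h3 := ((memx l).1 hl).2
      rw [he] at h3
      exact G.irrefl h3
    rw [Finset.card_insert_of_notMem, hcB] at hbB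
    rotate_left
    · simp only [Finset.mem_image, not_exists, not_and]
      intro l hl he
      have h3 := ((memy l).1 hl).2
      rw [he] at h3
      exact G.irrefl h3
    omega

/-- adding an edge -/
theorem HP.sup_edge {x y : V} {S : Finset V} {u v : V} (h : HP (G ⊔ SimpleGraph.edge x y) S u v) :
    HP G S u v ∨ ∃ S1 S2, Disjoint S1 S2 ∧ S = S1 ∪ S2 ∧
      ((HP G S1 u x ∧ HP G S2 y v) ∨ (HP G S1 u y ∧ HP G S2 x v)) := by
  induction h with
  | single u => exact Or.inl (HP.single u)
  | @cons S u w v hadj hu h ih =>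
    rw [SimpleGraph.sup_adj, SimpleGraph.edge_adj] at hadj
    rcases ih with ih | ⟨S1, S2, hd, rfl, ih⟩
    · rcases hadj with hadj | ⟨⟨rfl, rfl⟩ | ⟨rfl, rfl⟩, -⟩
      · exact Or.inl (HP.cons hadj hu ih)
      · exact Or.inr ⟨{u}, S, by simpa using hu, rfl, Or.inl ⟨HP.single u, ih⟩⟩
      · exact Or.inr ⟨{u}, S, by simpa using hu, rfl, Or.inr ⟨HP.single u, ih⟩⟩
    · simp only [Finset.mem_union, not_or] at hu
      have hxy : x ∈ S1 ∪ S2 ∧ y ∈ S1 ∪ S2 := by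
        rcases ih with ⟨h1, h2⟩ | ⟨h1, h2⟩
        · have := h1.right; have := h2.left; simp [*]
        · have := h1.right; have := h2.left; simp [*]
      simp only [Finset.mem_union] at hxy
      rcases hadj with hadj | ⟨⟨rfl, rfl⟩ | ⟨rfl, rfl⟩, -⟩
      · refine Or.inr ⟨insert u S1, S2, by simp [hd, hu.2], by rw [Finset.insert_union], ?_⟩
        rcases ih with ⟨h1, h2⟩ | ⟨h1, h2⟩
        · exact Or.inl ⟨HP.cons hadj hu.1 h1, h2⟩
        · exact Or.inr ⟨HP.cons hadj hu.1 h1, h2⟩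
      · tauto
      · tauto

theorem exists_maximal [Fintype V] {k : ℕ} (hk : 4 ≤ k) (hno : NoLong G k) :
    ∃ G' : SimpleGraph V, G ≤ G' ∧ NoLong G' k ∧
      ∀ x y, x ≠ y → ¬ G'.Adj x y → ∃ S, HP G' S x y ∧ k ≤ S.card := by
  obtain ⟨G', hle, hmax⟩ := (Set.toFinite {H : SimpleGraph V | NoLong H k}).exists_le_maximal hno
  refine ⟨G', hle, hmax.prop, ?_⟩
  intro x y hxy hnadj
  have hlt : ¬ NoLong (G' ⊔ SimpleGraph.edge x y) k := by
    intro hh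
    have := hmax.le_of_ge hh le_sup_left
    apply hnadj
    apply this
    rw [SimpleGraph.sup_adj, SimpleGraph.edge_adj]
    exact Or.inr ⟨Or.inl ⟨rfl, rfl⟩, hxy⟩
  unfold NoLong at hlt
  push Not at hlt
  obtain ⟨S, u, v, hS, hadj, hc⟩ := hlt
  rw [SimpleGraph.sup_adj, SimpleGraph.edge_adj] at hadj
  rcases hS.sup_edge with h | ⟨S1, S2, hd, rfl, h⟩
  · rcases hadj with hadj | ⟨⟨rfl, rfl⟩ | ⟨rfl, rfl⟩, -⟩
    · exact absurd (hmax.prop _ _ _ h hadj) (by omega)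
    · exact ⟨S, h, hc⟩
    · exact ⟨S, h.symm, hc⟩
  · rcases hadj with hadj | ⟨huv, -⟩
    · rcases h with ⟨h1, h2⟩ | ⟨h1, h2⟩
      · exact ⟨_, h1.symm.append hadj h2.symm hd, hc⟩
      · exact ⟨_, (h1.symm.append hadj h2.symm hd).symm, hc⟩
    · exfalso
      have hdis : ∀ z ∈ S1, z ∉ S2 := fun z hz => Finset.disjoint_left.1 hd hz
      rcases huv with ⟨rfl, rfl⟩ | ⟨rfl, rfl⟩ <;> rcases h with ⟨h1, h2⟩ | ⟨h1, h2⟩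
      · rw [h1.eq_single, h2.eq_single] at hc
        have := Finset.card_le_two (a := u) (b := v)
        rw [← Finset.insert_eq] at hc
        omega
      · exact hdis _ h1.left h2.left
      · exact hdis _ h1.left h2.left
      · rw [h1.eq_single, h2.eq_single] at hc
        have := Finset.card_le_two (a := u) (b := v)
        rw [← Finset.insert_eq] at hc
        omega

section arith

theorem choose_conv (q a b c : ℕ) (hab : a ≤ b) :
    (a + c).choose q + b.choose q ≤ (b + c).choose q + a.choose q := by
  cases q with
  | zero => simp
  | succ q =>
    induction c with
    | zero => simp; omega
    | succ c ih =>
      have h1 := Nat.choose_succ_succ' (a + c) q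
      have h2 := Nat.choose_succ_succ' (b + c) q
      have h3 : (a + c).choose q ≤ (b + c).choose q := Nat.choose_le_choose q (by omega)
      rw [← add_assoc, ← add_assoc]
      omega

theorem choose_lower (q d e x : ℕ) (h : d ≤ e + 1) :
    (e + 1).choose (q + 1) + x * d.choose q ≤ (e + x + 1).choose (q + 1) := by
  induction x with
  | zero => simp
  | succ x ih =>
    have h1 := Nat.choose_succ_succ' (e + x + 1) q
    have h3 : d.choose q ≤ (e + x + 1).choose q := Nat.choose_le_choose q (by omega)
    have h4 : (x + 1) * d.choose q = x * d.choose q + d.choose q := by ring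
    rw [← add_assoc]
    omega

theorem choose_upper (q d t x : ℕ) (h : t + x ≤ d) :
    (t + x + 1).choose (q + 1) ≤ (t + 1).choose (q + 1) + x * d.choose q := by
  induction x with
  | zero => simp
  | succ x ih =>
    have h1 := Nat.choose_succ_succ' (t + x + 1) q
    have h3 : (t + x + 1).choose q ≤ d.choose q := Nat.choose_le_choose q (by omega)
    have h4 : (x + 1) * d.choose q = x * d.choose q + d.choose q := by ring
    have := ih (by omega)
    rw [← add_assoc]
    omega

theorem choose_mid (q d l c : ℕ) (h : d = c + l + 1) :
    (2 * l + 1) * d.choose q + (c + 1).choose (q + 1) ≤ (d + l + 1).choose (q + 1) := by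
  induction l generalizing c with
  | zero =>
    subst h
    have := Nat.choose_succ_succ' (c + 1) q
    simp only [Nat.add_zero]
    omega
  | succ l ih =>
    have h1 := ih (c + 1) (by omega)
    have h2 := Nat.choose_succ_succ' (d + l + 1) q
    have h3 := Nat.choose_succ_succ' (c + 1) q
    have h4 := choose_conv q (c + 1) d (l + 1) (by omega)
    rw [show c + 1 + (l + 1) = d by omega] at h4
    have h5 : (2 * (l + 1) + 1) * d.choose q = (2 * l + 1) * d.choose q + 2 * d.choose q := by ring
    rw [← add_assoc] at h4 ⊢
    omega

/-- the bound -/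
def gb (p s m : ℕ) : ℕ := (m / p) * (p + 1).choose s + (m % p + 1).choose s

theorem gb_eq (p s r t : ℕ) (ht : t < p) :
    gb p s (r * p + t) = r * (p + 1).choose s + (t + 1).choose s := by
  unfold gb
  rw [mul_comm r p, Nat.mul_add_div (by omega), Nat.mul_add_mod, Nat.div_eq_of_lt ht,
    Nat.mod_eq_of_lt ht, add_zero]

theorem gb_add_p (p s m : ℕ) (hp : 0 < p) : gb p s (p + m) = (p + 1).choose s + gb p s m := by
  unfold gb
  rw [Nat.add_div_left _ hp, Nat.add_mod_left]
  ring

theorem gb_small (p s m : ℕ) (hs : 2 ≤ s) (hp : 0 < p) (hm : m ≤ p) :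
    gb p s m = (m + 1).choose s := by
  rcases Nat.lt_or_ge m p with h | h
  · have := gb_eq p s 0 m h
    simpa using this
  · have : m = p := by omega
    subst this
    have h1 := gb_add_p m s 0 hp
    have h2 := gb_eq m s 0 0 hp
    have h3 : Nat.choose (0 + 1) s = 0 := Nat.choose_eq_zero_of_lt (by omega)
    simp at h1 h2
    simp at h3
    rw [h1, h2, h3]; simp

theorem gb_superadd (p s a b : ℕ) (hs : 2 ≤ s) (hp : 0 < p) :
    gb p s a + gb p s b ≤ gb p s (a + b) := by
  have ha := gb_eq p s (a / p) (a % p) (Nat.mod_lt _ hp)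
  have hb := gb_eq p s (b / p) (b % p) (Nat.mod_lt _ hp)
  have ea : a / p * p + a % p = a := Nat.div_add_mod' a p
  have eb : b / p * p + b % p = b := Nat.div_add_mod' b p
  have la := Nat.mod_lt a hp
  have lb := Nat.mod_lt b hp
  rw [ea] at ha
  rw [eb] at hb
  generalize a / p = r at *
  generalize a % p = t at *
  generalize b / p = r' at *
  generalize b % p = t' at *
  have h3 : Nat.choose 1 s = 0 := Nat.choose_eq_zero_of_lt (by omega)
  rcases Nat.lt_or_ge (t + t') p with h | h
  · have := gb_eq p s (r + r') (t + t') h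
    rw [show (r + r') * p + (t + t') = a + b by rw [← ea, ← eb]; ring] at this
    have h4 := choose_conv s 1 (t + 1) t' (by omega)
    rw [show 1 + t' = t' + 1 by omega, show t + 1 + t' = t + t' + 1 by omega] at h4
    rw [ha, hb, this, add_mul]
    omega
  · obtain ⟨u, hu⟩ : ∃ u, t + t' = p + u := ⟨t + t' - p, by omega⟩
    have := gb_eq p s (r + r' + 1) u (by omega)
    rw [show (r + r' + 1) * p + u = a + b by
      rw [← ea, ← eb]; linarith] at this
    have h4 := choose_conv s (u + 1) (t' + 1) (t - u) (by omega)
    rw [show u + 1 + (t - u) = t + 1 by omega, show t' + 1 + (t - u) = p + 1 by omega] at h4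
    rw [ha, hb, this, add_mul, add_mul]
    omega

theorem gb_bound_aux (q p e d : ℕ) (hq : 1 ≤ q) (hp : 0 < p) (hd1 : 1 ≤ d) (hde : d ≤ e)
    (hep : e ≤ p) (hdep : d + e ≤ p + 1) :
    ∀ m, e ≤ m → (e + 1).choose (q + 1) + (m - e) * d.choose q ≤ gb p (q + 1) m := by
  obtain ⟨c, rfl⟩ : ∃ c, d = c + 1 := ⟨d - 1, by omega⟩
  have hz : Nat.choose 1 (q + 1) = 0 := Nat.choose_eq_zero_of_lt (by omega)
  have h4 := choose_mid q (c + 1) c 0 (by omega)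
  simp only [Nat.zero_add, hz] at h4
  intro m
  induction m using Nat.strong_induction_on with
  | _ m ih =>
    intro hem
    rcases Nat.lt_or_ge p m with hpm | hpm
    · rcases Nat.lt_or_ge m (p + e) with hm | hm
      · obtain ⟨t, rfl⟩ : ∃ t, m = p + t := ⟨m - p, by omega⟩
        obtain ⟨x, rfl⟩ : ∃ x, p = e + c + x := ⟨p - e - c, by omega⟩
        rw [gb_add_p _ _ _ hp, gb_small _ _ t (by omega) hp (by omega)]
        rw [show e + c + x + t - e = c + x + t by omega]
        have h1 := choose_lower q (c + 1) (e + c) x (by omega)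
        have h2 : (c + 1).choose (q + 1) + t * (c + 1).choose q ≤
            (t + 1).choose (q + 1) + c * (c + 1).choose q := by
          rcases Nat.lt_or_ge c t with h | h
          · obtain ⟨y, rfl⟩ : ∃ y, t = c + y := ⟨t - c, by omega⟩
            have := choose_lower q (c + 1) c y (by omega)
            rw [add_mul]
            omega
          · obtain ⟨y, rfl⟩ : ∃ y, c = t + y := ⟨c - t, by omega⟩
            have := choose_upper q (t + y + 1) t y (by omega)
            rw [add_mul]
            omega
        have h3 := choose_conv (q + 1) (c + 2) (e + 1) c (by omega)
        have h5 := Nat.choose_succ_succ' (c + 1) q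
        rw [show c + 2 + c = c + 1 + c + 1 by omega, show e + 1 + c = e + c + 1 by omega] at h3
        nlinarith
      · obtain ⟨m', rfl⟩ : ∃ m', m = p + m' := ⟨m - p, by omega⟩
        have := ih m' (by omega) (by omega)
        rw [gb_add_p _ _ _ hp]
        obtain ⟨x, hx⟩ : ∃ x, p = 2 * c + 1 + x := ⟨p - (2 * c + 1), by omega⟩
        have h1 := choose_lower q (c + 1) (2 * c + 1) x (by omega)
        rw [← hx] at h1
        rw [show c + 1 + c + 1 = 2 * c + 1 + 1 by omega] at h4
        have h6 : p * (c + 1).choose q = (2 * c + 1) * (c + 1).choose q + x * (c + 1).choose q := by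
          rw [hx]; ring
        rw [show p + m' - e = p + (m' - e) by omega, add_mul]
        omega
    · rw [gb_small _ _ _ (by omega) hp hpm]
      have := choose_lower q (c + 1) e (m - e) (by omega)
      rwa [show e + (m - e) = m by omega] at this

theorem gb_bound (s p h d n : ℕ) (hs : 2 ≤ s) (hp : 0 < p) (hdh : d < h)
    (hhp : h ≤ p + 1) (hdhp : d + h ≤ p + 2) (hn : h ≤ n) :
    h.choose s + (n - h) * d.choose (s - 1) ≤ gb p s (n - 1) := by
  obtain ⟨q, rfl⟩ : ∃ q, s = q + 1 := ⟨s - 1, by omega⟩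
  obtain ⟨e, rfl⟩ : ∃ e, h = e + 1 := ⟨h - 1, by omega⟩
  obtain ⟨m, rfl⟩ : ∃ m, n = m + 1 := ⟨n - 1, by omega⟩
  simp only [Nat.add_sub_cancel, Nat.add_sub_add_right]
  rcases Nat.eq_zero_or_pos d with rfl | hd
  · have h0 : Nat.choose 0 q = 0 := Nat.choose_eq_zero_of_lt (by omega)
    rcases Nat.eq_zero_or_pos e with rfl | he
    · have hz : Nat.choose 1 (q + 1) = 0 := Nat.choose_eq_zero_of_lt (by omega)
      simp only [Nat.zero_add, h0, hz, Nat.mul_zero]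
      omega
    · have := gb_bound_aux q p e 1 (by omega) hp le_rfl he (by omega) (by omega) m (by omega)
      rw [h0]
      omega
  · exact gb_bound_aux q p e d (by omega) hp hd (by omega) (by omega) (by omega) m (by omega)

end arith

section count

open Classical in
/-- number of s-cliques inside W -/
noncomputable def cl (G : SimpleGraph V) (s : ℕ) (W : Finset V) : ℕ :=
  ((W.powersetCard s).filter (fun T : Finset V => G.IsClique (T : Set V))).card

theorem cl_le (s : ℕ) (W : Finset V) : cl G s W ≤ W.card.choose s := by
  classical
  unfold cl
  refine (Finset.card_filter_le _ _).trans ?_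
  rw [Finset.card_powersetCard]

open Classical in
theorem cl_erase (s : ℕ) (hs : 2 ≤ s) (W : Finset V) (v : V) (hv : v ∈ W) :
    cl G s W ≤ cl G s (W.erase v) + (W.filter (G.Adj v)).card.choose (s - 1) := by
  unfold cl
  rw [← Finset.card_powersetCard]
  have hsplit := Finset.card_filter_add_card_filter_not (fun T : Finset V => v ∉ T)
    (s := (W.powersetCard s).filter (fun T : Finset V => G.IsClique (T : Set V)))
  rw [← hsplit]
  apply Nat.add_le_add
  · apply Finset.card_le_card
    intro T
    simp only [Finset.mem_filter, Finset.mem_powersetCard]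
    rintro ⟨⟨⟨h1, h2⟩, h3⟩, h4⟩
    exact ⟨⟨fun x hx => Finset.mem_erase.2 ⟨by rintro rfl; exact h4 hx, h1 hx⟩, h2⟩, h3⟩
  · apply Finset.card_le_card_of_injOn (fun T => T.erase v)
    · intro T
      simp only [Finset.coe_filter, Finset.mem_filter, Finset.mem_powersetCard, Set.mem_ofPred_eq,
        Finset.mem_coe, not_not]
      rintro ⟨⟨⟨h1, h2⟩, h3⟩, h4⟩
      refine ⟨?_, by rw [Finset.card_erase_of_mem h4, h2]⟩
      intro x hx
      rw [Finset.mem_erase] at hx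
      exact Finset.mem_filter.2 ⟨h1 hx.2, h3 h4 hx.2 hx.1.symm⟩
    · intro T hT T' hT' he
      simp only [Finset.coe_filter, Finset.mem_filter, Set.mem_ofPred_eq, not_not] at hT hT'
      simp only at he
      rw [← Finset.insert_erase hT.2, ← Finset.insert_erase hT'.2, he]

open Classical in
theorem disint (s : ℕ) (hs : 2 ≤ s) (H : Finset V) (h d : ℕ)
    (hH : ∀ W : Finset V, H ⊆ W → h < W.card → ∃ v ∈ W, v ∉ H ∧ (W.filter (G.Adj v)).card ≤ d) :
    ∀ (x : ℕ) (W : Finset V), H ⊆ W → W.card = h + x →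
      cl G s W ≤ h.choose s + x * d.choose (s - 1) := by
  intro x
  induction x with
  | zero =>
    intro W hHW hc
    have := cl_le (G := G) s W
    rw [hc] at this
    simpa using this
  | succ x ih =>
    intro W hHW hc
    obtain ⟨v, hv, hvH, hvd⟩ := hH W hHW (by omega)
    have h1 := cl_erase (G := G) s hs W v hv
    have h2 := ih (W.erase v)
      (fun z hz => Finset.mem_erase.2 ⟨by rintro rfl; exact hvH hz, hHW hz⟩)
      (by rw [Finset.card_erase_of_mem hv]; omega)
    have h3 := Nat.choose_le_choose (s - 1) hvd
    rw [add_mul]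
    omega

open Classical in
theorem exists_core [Fintype V] (G : SimpleGraph V) (d : ℕ) : ∃ H : Finset V,
    (∀ x ∈ H, d + 1 ≤ (H.filter (G.Adj x)).card) ∧
    ∀ X : Finset V, (∀ x ∈ X, d + 1 ≤ (X.filter (G.Adj x)).card) → X ⊆ H := by
  let P : Finset V → Prop := fun X => ∀ x ∈ X, d + 1 ≤ (X.filter (G.Adj x)).card
  let H : Finset V := Finset.univ.filter (fun v => ∃ X, P X ∧ v ∈ X)
  have hsub : ∀ X, P X → X ⊆ H := fun X hX v hv => by
    simp only [H, Finset.mem_filter, Finset.mem_univ, true_and]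
    exact ⟨X, hX, hv⟩
  refine ⟨H, ?_, hsub⟩
  intro x hx
  simp only [H, Finset.mem_filter, Finset.mem_univ, true_and] at hx
  obtain ⟨X, hX, hxX⟩ := hx
  exact (hX x hxX).trans (Finset.card_le_card (Finset.filter_subset_filter _ (hsub X hX)))

theorem longest [Fintype V] {k : ℕ} (hno : NoLong G k)
    (hmax : ∀ x y, x ≠ y → ¬ G.Adj x y → ∃ S, HP G S x y ∧ k ≤ S.card)
    (X Y : Finset V) (hex : ∃ x ∈ X, ∃ y ∈ Y, x ≠ y ∧ ¬ G.Adj x y) :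
    ∃ x ∈ X, ∃ y ∈ Y, ∃ S, HP G S x y ∧ k ≤ S.card ∧
      (∀ z ∈ X, G.Adj x z → z ∈ S) ∧ (∀ z ∈ Y, G.Adj y z → z ∈ S) := by
  classical
  let P : ℕ → Prop := fun N => ∃ x ∈ X, ∃ y ∈ Y, ∃ S, x ≠ y ∧ ¬ G.Adj x y ∧ HP G S x y ∧ S.card = N
  obtain ⟨x0, hx0, y0, hy0, hne0, hna0⟩ := hex
  obtain ⟨S0, hS0, hc0⟩ := hmax x0 y0 hne0 hna0
  have hP0 : P S0.card := ⟨x0, hx0, y0, hy0, S0, hne0, hna0, hS0, rfl⟩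
  have hb : ∀ N, P N → N ≤ Fintype.card V := by
    rintro N ⟨x, -, y, -, S, -, -, -, rfl⟩
    exact Finset.card_le_univ S
  obtain ⟨x, hx, y, hy, S, hne, hna, hS, hc⟩ : P (Nat.findGreatest P (Fintype.card V)) :=
    Nat.findGreatest_spec (hb _ hP0) hP0
  have hg : ∀ N, P N → N ≤ S.card := by
    intro N hN
    rw [hc]
    exact Nat.le_findGreatest (hb _ hN) hN
  have hkS : k ≤ S.card := hc0.trans (hg _ hP0)
  refine ⟨x, hx, y, hy, S, hS, hkS, ?_, ?_⟩
  · intro z hz hxz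
    by_contra hzS
    have hp := HP.cons hxz.symm hzS hS
    have hcard : (insert z S).card = S.card + 1 := Finset.card_insert_of_notMem hzS
    by_cases hzy : G.Adj z y
    · have := hno _ _ _ hp hzy
      omega
    · have := hg _ ⟨z, hz, y, hy, insert z S, by rintro rfl; exact hzS hS.right, hzy, hp, rfl⟩
      omega
  · intro z hz hyz
    by_contra hzS
    have hp := hS.snoc hyz hzS
    have hcard : (insert z S).card = S.card + 1 := Finset.card_insert_of_notMem hzS
    by_cases hzy : G.Adj x z
    · have := hno _ _ _ hp hzy
      omega
    · have := hg _ ⟨x, hx, z, hz, insert z S, by rintro rfl; exact hzS hS.left, hzy, hp, rfl⟩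
      omega

theorem clique_path (C : Finset V) (hC : C.Nonempty) (hcl : G.IsClique (C : Set V)) :
    ∃ u v, HP G C u v := by
  induction hC using Finset.Nonempty.cons_induction with
  | singleton a => exact ⟨a, a, HP.single a⟩
  | cons a s ha hs ih =>
    rw [Finset.cons_eq_insert] at hcl ⊢
    obtain ⟨u, v, h⟩ := ih (hcl.subset (by simp))
    exact ⟨a, v, h.cons (hcl (by simp) (by simp [h.left]) (by rintro rfl; exact ha h.left)) ha⟩

open Classical in
theorem twoconn [Fintype V] {k : ℕ} (s : ℕ) (hs : 2 ≤ s) (hk : 4 ≤ k) (h2 : NoSep G)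
    (hno : NoLong G k)
    (hmax : ∀ x y, x ≠ y → ¬ G.Adj x y → ∃ S, HP G S x y ∧ k ≤ S.card)
    (hn : k ≤ Fintype.card V) :
    cl G s Finset.univ ≤ gb (k - 2) s (Fintype.card V - 1) := by
  have hfilt : ∀ (x : V) (X S : Finset V), (∀ z ∈ X, G.Adj x z → z ∈ S) →
      (X.filter (G.Adj x)).card ≤ (S.filter (G.Adj x)).card := by
    intro x X S h
    apply Finset.card_le_card
    intro z
    simp only [Finset.mem_filter]
    exact fun hz => ⟨h z hz.1 hz.2, hz.2⟩
  suffices ∃ h d, h + d ≤ k ∧ d < h ∧ h ≤ k - 1 ∧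
      cl G s Finset.univ ≤ h.choose s + (Fintype.card V - h) * d.choose (s - 1) by
    obtain ⟨h, d, h1, h3, h4, h5⟩ := this
    exact h5.trans (gb_bound s (k - 2) h d _ hs (by omega) h3 (by omega) (by omega) (by omega))
  let α := (k - 1) / 2
  have hα1 : 2 * α + 1 ≤ k := by simp only [α]; omega
  have hα2 : k ≤ 2 * α + 2 := by simp only [α]; omega
  obtain ⟨H, hH1, hH2⟩ := exists_core G α
  have hclq : G.IsClique (H : Set V) := by
    intro x hx y hy hxy
    by_contra hna
    obtain ⟨x, hx, y, hy, S, hS, hkS, hxS, hyS⟩ := longest hno hmax H H ⟨x, hx, y, hy, hxy, hna⟩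
    have := kop h2 hno hk hS hkS
    have := hfilt x H S hxS
    have := hfilt y H S hyS
    have := hH1 x hx
    have := hH1 y hy
    omega
  rcases Finset.eq_empty_or_nonempty H with hHe | hHne
  · refine ⟨α + 1, α, by omega, by omega, by omega, ?_⟩
    refine disint s hs ∅ (α + 1) α ?_ _ Finset.univ (by simp) (by rw [Finset.card_univ]; omega)
    intro W _ hW
    by_contra hcon
    push Not at hcon
    have := hH2 W (fun x hx => hcon x hx (by simp))
    rw [hHe, Finset.subset_empty] at this
    simp [this] at hW
  · have hHk : H.card < k := by
      by_contra hge
      obtain ⟨u, v, huv⟩ := clique_path H hHne hclq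
      have hne : u ≠ v := by
        rintro rfl
        rw [huv.eq_single] at hge
        simp at hge
        omega
      exact hge (hno _ _ _ huv (hclq huv.left huv.right hne))
    have hHα : α + 2 ≤ H.card := by
      obtain ⟨x, hx⟩ := hHne
      have h1 := hH1 x hx
      have : (insert x (H.filter (G.Adj x))).card ≤ H.card := by
        apply Finset.card_le_card
        intro z hz
        simp only [Finset.mem_insert, Finset.mem_filter] at hz
        rcases hz with rfl | hz
        · exact hx
        · exact hz.1
      rw [Finset.card_insert_of_notMem (by simp)] at this
      omega
    have hHdeg : ∀ x ∈ H, H.card - 1 ≤ (H.filter (G.Adj x)).card := by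
      intro x hx
      rw [← Finset.card_erase_of_mem hx]
      apply Finset.card_le_card
      intro z hz
      rw [Finset.mem_erase] at hz
      exact Finset.mem_filter.2 ⟨hz.2, hclq hx hz.2 hz.1.symm⟩
    obtain ⟨K, hK1, hK2⟩ := exists_core G (k - H.card)
    have hHK : H ⊆ K := hK2 H (fun x hx => (by
      have := hH1 x hx
      omega))
    have hKH : K ⊆ H := by
      by_contra hcon
      obtain ⟨y0, hy0K, hy0H⟩ := Finset.not_subset.1 hcon
      have hx0 : ∃ x0 ∈ H, ¬ G.Adj x0 y0 := by
        by_contra hall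
        push Not at hall
        apply hy0H
        refine hH2 (insert y0 H) ?_ (by simp)
        intro x hx
        rcases Finset.mem_insert.1 hx with rfl | hx
        · have : H ⊆ (insert x H).filter (G.Adj x) := by
            intro z hz
            simp only [Finset.mem_filter, Finset.mem_insert]
            exact ⟨Or.inr hz, (hall z hz).symm⟩
          have := Finset.card_le_card this
          omega
        · exact (hH1 x hx).trans (Finset.card_le_card
            (Finset.filter_subset_filter _ (Finset.subset_insert _ _)))
      obtain ⟨x0, hx0H, hx0⟩ := hx0
      obtain ⟨x, hx, y, hy, S, hS, hkS, hxS, hyS⟩ := longest hno hmax H (K \ H)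
        ⟨x0, hx0H, y0, by simp [hy0K, hy0H], by rintro rfl; exact hy0H hx0H, hx0⟩
      have hHS : ∀ z ∈ H, z ∈ S := by
        intro z hz
        by_cases hzx : z = x
        · subst hzx; exact hS.left
        · exact hxS z hz (hclq hx hz (Ne.symm hzx))
      have h3 := kop h2 hno hk hS hkS
      have h4 := hfilt x H S hxS
      have h5 := hfilt y K S (by
        intro z hz hyz
        by_cases hzH : z ∈ H
        · exact hHS z hzH
        · exact hyS z (by simp [hz, hzH]) hyz)
      have h6 := hHdeg x hx
      have h7 := hK1 y (Finset.mem_sdiff.1 hy).1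
      omega
    refine ⟨H.card, k - H.card, by omega, by omega, by omega, ?_⟩
    have hcu : H.card ≤ Fintype.card V := Finset.card_le_univ H
    refine disint s hs H H.card (k - H.card) ?_ _ Finset.univ (by simp)
      (by rw [Finset.card_univ]; omega)
    intro W hHW hW
    by_contra hcon
    push Not at hcon
    have : W ⊆ K := hK2 W (by
      intro x hx
      by_cases hxH : x ∈ H
      · have h1 := hH1 x hxH
        have h3 : (H.filter (G.Adj x)).card ≤ (W.filter (G.Adj x)).card :=
          Finset.card_le_card (Finset.filter_subset_filter _ hHW)
        omega
      · exact hcon x hx hxH)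
    have := Finset.card_le_card (this.trans hKH)
    omega

end count

theorem ncard_eq_cl [Fintype V] (s : ℕ) : (G.cliqueSet s).ncard = cl G s Finset.univ := by
  classical
  unfold cl
  rw [← Set.ncard_coe_finset]
  congr 1
  ext T
  simp [SimpleGraph.mem_cliqueSet_iff, SimpleGraph.isNClique_iff, and_comm]

end Kop

open Kop in
theorem Kop.main_bound {k : ℕ} (s : ℕ) (hs : 2 ≤ s) (hk : 4 ≤ k) : ∀ (N : ℕ) {V : Type*} [DecidableEq V] [Fintype V]
    (G : SimpleGraph V), Fintype.card V = N → NoLong G k →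
    (G.cliqueSet s).ncard ≤ gb (k - 2) s (N - 1) := by
  intro N
  induction N using Nat.strong_induction_on with
  | _ N ih =>
    intro V _ _ G0 hN hno0
    classical
    rcases Nat.lt_or_ge N k with hNk | hNk
    · rw [ncard_eq_cl, gb_small _ _ _ hs (by omega) (by omega)]
      refine (cl_le s _).trans ?_
      rw [Finset.card_univ, hN]
      exact Nat.choose_le_choose s (by omega)
    obtain ⟨G, hle, hno, hmax⟩ := exists_maximal hk hno0
    have hGG : (G0.cliqueSet s).ncard ≤ (G.cliqueSet s).ncard :=
      Set.ncard_le_ncard (fun T hT => by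
        rw [SimpleGraph.mem_cliqueSet_iff] at hT ⊢
        exact hT.mono hle) (Set.toFinite _)
    refine hGG.trans ?_
    by_cases h2 : NoSep G
    · rw [ncard_eq_cl, ← hN]
      exact twoconn s hs hk h2 hno hmax (by omega)
    · unfold NoSep at h2
      push Not at h2
      obtain ⟨b, C, ⟨c0, hc0⟩, hbC, ⟨y0, hy0C, hy0b⟩, hsep⟩ := h2
      have hind : ∀ W : Set V, Nat.card W < N →
          ((G.induce W).cliqueSet s).ncard ≤ gb (k - 2) s (Nat.card W - 1) := by
        intro W hW
        refine ih _ hW (G.induce W) Nat.card_eq_fintype_card.symm ?_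
        intro S u v hS ha
        have h1 := hS.map (H := G) (Function.Embedding.subtype (· ∈ W)) (by intro a b h; exact h)
        have := hno _ _ _ h1 ha
        simpa using this
      have hcliq : ∀ W : Set V, ∀ T ∈ G.cliqueSet s, (T : Set V) ⊆ W →
          T ∈ (fun T : Finset W => T.map (Function.Embedding.subtype (· ∈ W))) ''
            ((G.induce W).cliqueSet s) := by
        intro W T hT hTW
        have hmapT : (T.subtype (· ∈ W)).map (Function.Embedding.subtype (· ∈ W)) = T :=
          Finset.subtype_map_of_mem (fun x hx => hTW hx)
        rw [SimpleGraph.mem_cliqueSet_iff, SimpleGraph.isNClique_iff] at hT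
        refine ⟨T.subtype (· ∈ W), ?_, hmapT⟩
        rw [SimpleGraph.mem_cliqueSet_iff, SimpleGraph.isNClique_iff]
        constructor
        · intro x hx y hy hxy
          simp at hx hy
          exact hT.1 hx hy (fun h => hxy (Subtype.ext h))
        · rw [← hT.2, ← Finset.card_map (Function.Embedding.subtype (· ∈ W)), hmapT]
      let W1 : Set V := insert b C
      let W2 : Set V := Cᶜ
      have hcov : G.cliqueSet s ⊆
          ((fun T : Finset W1 => T.map (Function.Embedding.subtype (· ∈ W1))) ''
            ((G.induce W1).cliqueSet s)) ∪
          ((fun T : Finset W2 => T.map (Function.Embedding.subtype (· ∈ W2))) ''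
            ((G.induce W2).cliqueSet s)) := by
        intro T hT
        by_cases h1 : (T : Set V) ⊆ W1
        · exact Or.inl (hcliq W1 T hT h1)
        · refine Or.inr (hcliq W2 T hT ?_)
          obtain ⟨d, hdT, hd⟩ := Set.not_subset.1 h1
          intro c hcT hcC
          simp only [W1, Set.mem_insert_iff, not_or] at hd
          rw [SimpleGraph.mem_cliqueSet_iff, SimpleGraph.isNClique_iff] at hT
          exact hsep c hcC d hd.2 hd.1 (hT.1 hcT hdT (by rintro rfl; exact hd.2 hcC))
      have hcard1 : Nat.card W1 = Nat.card C + 1 := by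
        simp only [W1]
        rw [Nat.card_coe_set_eq,
          Nat.card_coe_set_eq, Set.ncard_insert_of_notMem hbC (Set.toFinite _)]
      have hcard2 : Nat.card W2 = N - Nat.card C := by
        simp only [W2]
        rw [Nat.card_eq_fintype_card, Nat.card_eq_fintype_card, Fintype.card_compl_set, hN]
      have hC1 : 0 < Nat.card C := by
        rw [Nat.card_eq_fintype_card]
        exact Fintype.card_pos_iff.2 ⟨⟨c0, hc0⟩⟩
      have hC2 : Nat.card C + 2 ≤ N := by
        have h1 : 1 < Nat.card W2 := by
          rw [Nat.card_eq_fintype_card]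
          exact Fintype.one_lt_card_iff.2 ⟨⟨b, hbC⟩, ⟨y0, hy0C⟩, fun h => hy0b (congrArg Subtype.val h).symm⟩
        omega
      have h3 := Set.ncard_le_ncard hcov (Set.toFinite _)
      have h4 := h3.trans (Set.ncard_union_le _ _)
      have h5 := Set.ncard_image_le (Set.toFinite ((G.induce W1).cliqueSet s))
        (f := fun T : Finset W1 => T.map (Function.Embedding.subtype (· ∈ W1)))
      have h6 := Set.ncard_image_le (Set.toFinite ((G.induce W2).cliqueSet s))
        (f := fun T : Finset W2 => T.map (Function.Embedding.subtype (· ∈ W2)))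
      have h7 := hind W1 (by omega)
      have h8 := hind W2 (by omega)
      have h9 := gb_superadd (k - 2) s (Nat.card W1 - 1) (Nat.card W2 - 1) hs (by omega)
      rw [show Nat.card W1 - 1 + (Nat.card W2 - 1) = N - 1 by omega] at h9
      omega

theorem stmt_12 {V : Type*} [Fintype V] (G : SimpleGraph V) (n k s r t : ℕ)
    (hn : Fintype.card V = n) (hn2 : 2 ≤ n) (hk : 4 ≤ k) (hs : 2 ≤ s)
    (hconn : G.Connected)
    (ht : t ≤ k - 3) (hrt : n - 1 = r * (k - 2) + t)
    (hcyc : ∀ (a : V) (w : G.Walk a a), w.IsCycle → w.length < k) :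
    (G.cliqueSet s).ncard ≤ r * Nat.choose (k - 1) s + Nat.choose (t + 1) s := by
  classical
  have h := Kop.main_bound s hs hk n G hn (by
    intro S u v hS ha
    by_contra hge
    obtain ⟨w, hw, hl⟩ := hS.exists_cycle ha (by omega)
    have := hcyc u w hw
    omega)
  rw [hrt, Kop.gb_eq _ _ _ _ (by omega), show k - 2 + 1 = k - 1 by omega] at h
  exact h
end

section
/- Let G be a 2-connected graph on n ≥ 3 vertices, and let k ≥ 4 and s ≥ 2 be integers. If G has an edge uv such that no cycle of G containing uv has length at least k, then N_s(G) ≤ r·C(k-1, s) + C(t+2, s), where n-2 = r(k-3) + t with 0 ≤ t ≤ k-4. -/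
/-- A graph is 2-connected if it has at least 3 vertices and remains connected
after deleting any single vertex. -/
def TwoConnected {V : Type*} (G : SimpleGraph V) : Prop :=
  3 ≤ Nat.card V ∧ ∀ v : V, (G.induce {w : V | w ≠ v}).Connected

namespace Cliq

/-- partial sums -/
def PS (f : ℕ → ℕ) (n : ℕ) : ℕ := ∑ i ∈ Finset.range n, f i

/-- block bound -/
def GB (f : ℕ → ℕ) (m n : ℕ) : ℕ := (n / m) * PS f m + PS f (n % m)

/-- convexity and monotonicity -/
def Cvx (f : ℕ → ℕ) : Prop := Monotone f ∧ ∀ i, 2 * f (i + 1) ≤ f i + f (i + 2)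

theorem PS_succ (f : ℕ → ℕ) (n : ℕ) : PS f (n + 1) = PS f n + f n := by
  simp [PS, Finset.sum_range_succ]

theorem PS_zero (f : ℕ → ℕ) : PS f 0 = 0 := by simp [PS]

theorem PS_shift (f : ℕ → ℕ) (n : ℕ) : PS f (n + 1) = f 0 + PS (fun i => f (1 + i)) n := by
  simp [PS, Finset.sum_range_succ', add_comm]

theorem PS_add (f : ℕ → ℕ) (a b : ℕ) : PS f (a + b) = PS f a + PS (fun i => f (a + i)) b := by
  simp [PS, Finset.sum_range_add]

theorem PS_le (f : ℕ → ℕ) (hf : Monotone f) (n : ℕ) : PS f (n + 1) ≤ (n + 1) * f n := by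
  have := Finset.sum_le_card_nsmul (Finset.range (n+1)) f (f n)
    (fun i hi => hf (by simpa [Nat.lt_succ_iff] using hi))
  simpa [PS] using this

theorem le_PS (f : ℕ → ℕ) (hf : Monotone f) (n : ℕ) : n * f 0 ≤ PS f n := by
  have := Finset.card_nsmul_le_sum (Finset.range n) f (f 0) (fun i hi => hf (Nat.zero_le _))
  simpa [PS] using this

theorem le_PS_add (f : ℕ → ℕ) (hf : Monotone f) (a b i : ℕ) (h : i ≤ a) :
    PS f a + b * f i ≤ PS f (a + b) := by
  rw [PS_add]
  have := le_PS (fun i => f (a + i)) (fun x y h => hf (by omega)) b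
  have h2 : f i ≤ f (a + 0) := hf (by omega)
  have h3 := Nat.mul_le_mul_left b h2
  have h4 : b * f (a + 0) ≤ PS (fun i => f (a + i)) b := this
  omega

theorem Cvx.shift {f : ℕ → ℕ} (hf : Cvx f) (c : ℕ) : Cvx (fun i => f (c + i)) :=
  ⟨fun x y h => hf.1 (by omega), fun i => hf.2 (c + i)⟩

theorem avg_mono (f : ℕ → ℕ) (hf : Monotone f) {p q : ℕ} (h : p ≤ q) :
    q * PS f p ≤ p * PS f q := by
  obtain ⟨d, rfl⟩ := Nat.exists_eq_add_of_le h
  rcases p with _ | p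
  · simp [PS_zero]
  · have h1 := le_PS_add f hf (p+1) d p (by omega)
    have h2 := PS_le f hf p
    nlinarith [Nat.mul_le_mul_left d h2, Nat.mul_le_mul_left (p+1) h1]

theorem pair_step {f : ℕ → ℕ} (hf : Cvx f) (i d : ℕ) : f (i+1) + f (i + d) ≤ f i + f (i + d + 1) := by
  induction d with
  | zero => simp; omega
  | succ d ih => 
    have h := hf.2 (i + d)
    have e : i + d + 2 = i + (d + 1) + 1 := by ring
    have e1 : i + d + 1 = i + (d + 1) := by ring
    rw [e, e1] at h
    rw [e1] at ih
    omega

theorem pair {f : ℕ → ℕ} (hf : Cvx f) (i j : ℕ) : 2 * f (i + j) ≤ f i + f (i + j + j) := by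
  induction j generalizing i with
  | zero => simp; omega
  | succ j ih =>
    have h1 := ih (i+1)
    have h2 := pair_step hf i (2 * j + 1)
    have e1 : i + 1 + j = i + (j + 1) := by ring
    have e2 : i + 1 + j + j = i + (2 * j + 1) := by ring
    have e3 : i + (j+1) + (j+1) = i + (2 * j + 1) + 1 := by ring
    rw [e2, e1] at h1
    rw [e3]; omega

theorem sym_sum {f : ℕ → ℕ} (hf : Cvx f) (a j : ℕ) (hj : j ≤ a) :
    (2 * j) * f a + PS f (a - j) + f a ≤ PS f (a - j) + PS (fun i => f (a - j + i)) (2 * j + 1) := by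
  induction j with
  | zero => simp [PS]
  | succ j ih =>
    have ih := ih (by omega)
    obtain ⟨b, rfl⟩ := Nat.exists_eq_add_of_le hj
    have e1 : j + 1 + b - (j+1) = b := by omega
    have e2 : j + 1 + b - j = b + 1 := by omega
    rw [e1]; rw [e2] at ih
    have h3 : 2 * (j+1) + 1 = (2 * j + 1 + 1) + 1 := by ring
    rw [h3, PS_succ, PS_shift]
    have h4 := pair hf b (j+1)
    have e5 : b + (j+1) = j + 1 + b := by ring
    have e6 : b + (j+1) + (j+1) = b + (2*j+1+1) := by ring
    rw [e6, e5] at h4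
    have e7 : (fun i => f (b + (1 + i))) = fun i => f (b + 1 + i) := by funext i; congr 1; ring
    rw [e7]
    have e8 : f (b + 0) = f b := rfl
    rw [e8]
    have e9 : f (b + (2 * j + 1 + 1)) = f (b + (2 * j + 2)) := rfl
    rw [e9] at h4
    have : 2 * (j+1) * f (j+1+b) = 2 * j * f (j+1+b) + 2 * f (j+1+b) := by ring
    omega

theorem jensen0 {f : ℕ → ℕ} (hf : Cvx f) (a : ℕ) : (2 * a + 1) * f a ≤ PS f (2 * a + 1) := by
  have := sym_sum hf a a le_rfl
  simp at this
  linarith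

theorem jensen {f : ℕ → ℕ} (hf : Cvx f) (a y : ℕ) (h : 2 * a + 1 ≤ y) : y * f a ≤ PS f y := by
  obtain ⟨d, rfl⟩ := Nat.exists_eq_add_of_le h
  have := jensen0 hf a
  have := le_PS_add f hf.1 (2*a+1) d a (by omega)
  nlinarith

theorem PS_super {f : ℕ → ℕ} (hf : Monotone f) (b j d : ℕ) :
    PS f (b + j) + PS f (b + d) ≤ PS f (b + j + d) + PS f b := by
  rw [PS_add f (b+j) d, PS_add f b d]
  have : PS (fun i => f (b + i)) d ≤ PS (fun i => f (b + j + i)) d :=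
    Finset.sum_le_sum (fun i _ => hf (by omega))
  omega

theorem GB_eq (f : ℕ → ℕ) {m q t : ℕ} (h : t < m) : GB f m (q * m + t) = q * PS f m + PS f t := by
  have h0 : 0 < m := by omega
  simp only [GB]
  have : (q * m + t) / m = q := by
    rw [add_comm, Nat.add_mul_div_right _ _ h0, Nat.div_eq_of_lt h]; simp
  have h2 : (q * m + t) % m = t := by
    rw [add_comm, Nat.add_mul_mod_self_right, Nat.mod_eq_of_lt h]
  rw [this, h2]

theorem GB_eq' (f : ℕ → ℕ) {m q t : ℕ} (h0 : 0 < m) (h : t ≤ m) :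
    GB f m (q * m + t) = q * PS f m + PS f t := by
  rcases h.lt_or_eq with h | rfl
  · exact GB_eq f h
  · have : q * t + t = (q+1) * t + 0 := by ring
    rw [this, GB_eq f h0, PS_zero]; ring

theorem GB_super {f : ℕ → ℕ} (hf : Monotone f) {m : ℕ} (h0 : 0 < m) (a b : ℕ) :
    GB f m a + GB f m b ≤ GB f m (a + b) := by
  have ha := Nat.mod_lt a h0
  have hb := Nat.mod_lt b h0
  have ea : a = (a / m) * m + a % m := by rw [mul_comm]; exact (Nat.div_add_mod a m).symm
  have eb : b = (b / m) * m + b % m := by rw [mul_comm]; exact (Nat.div_add_mod b m).symm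
  generalize a / m = q at *
  generalize b / m = q' at *
  generalize a % m = t at *
  generalize b % m = t' at *
  subst ea eb
  rw [GB_eq f ha, GB_eq f hb]
  by_cases h : t + t' ≤ m
  · have : q * m + t + (q' * m + t') = (q + q') * m + (t + t') := by ring
    rw [this, GB_eq' f h0 h]
    have := PS_super hf 0 t t'
    simp [PS_zero] at this
    nlinarith
  · obtain ⟨d, hd⟩ := Nat.exists_eq_add_of_le (not_le.mp h).le
    have : q * m + t + (q' * m + t') = (q + q' + 1) * m + d := by rw [add_mul, add_mul]; omega
    rw [this, GB_eq f (by omega)]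
    have := PS_super hf d (t - d) (t' - d)
    have e1 : d + (t - d) = t := by omega
    have e2 : d + (t' - d) = t' := by omega
    have e3 : t + (t' - d) = m := by omega
    rw [e1, e2, e3] at this
    nlinarith

theorem GB_step {f : ℕ → ℕ} (hf : Monotone f) {m : ℕ} (h0 : 0 < m) (n : ℕ) :
    GB f m n + f 0 ≤ GB f m (n + 1) := by
  have h := GB_super hf h0 n 1
  have : GB f m 1 = f 0 := by
    have := GB_eq' f (m := m) (q := 0) (t := 1) h0 h0
    simpa [PS] using this
  omega

theorem GB_small (f : ℕ → ℕ) {m n : ℕ} (h0 : 0 < m) (h : n ≤ m) : GB f m n = PS f n := by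
  have := GB_eq' f (m := m) (q := 0) (t := n) h0 h
  simpa using this

theorem tail_bound {f : ℕ → ℕ} (hf : Monotone f) (a t : ℕ) :
    t * f a + PS f a ≤ a * f a + PS f t := by
  rcases le_total t a with h | h
  · obtain ⟨d, rfl⟩ := Nat.exists_eq_add_of_le h
    rw [PS_add]
    have : PS (fun i => f (t + i)) d ≤ d * f (t + d) := by
      rcases d with _ | d
      · simp [PS]
      · have := PS_le (fun i => f (t + i)) (fun x y h => hf (by omega)) d
        refine this.trans (Nat.mul_le_mul_left _ (hf (by omega)))
    nlinarith
  · obtain ⟨d, rfl⟩ := Nat.exists_eq_add_of_le h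
    have := le_PS_add f hf a d a le_rfl
    nlinarith

theorem final_ineq {f : ℕ → ℕ} (hf : Cvx f) {m n a : ℕ} (ha : 2 * a + 1 ≤ m) (hmn : m ≤ n) :
    PS f (m - a) + (n - m + a) * f a ≤ GB f m n := by
  obtain ⟨j, rfl⟩ := Nat.exists_eq_add_of_le hmn
  have h0 : 0 < m := by omega
  have ej : j = (j / m) * m + j % m := by rw [mul_comm]; exact (Nat.div_add_mod j m).symm
  have hj := Nat.mod_lt j h0
  generalize j / m = q at *
  generalize j % m = t at *
  subst ej
  have e1 : m + (q * m + t) = (q + 1) * m + t := by ring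
  have e2 : m + (q * m + t) - m = q * m + t := by omega
  rw [e2, e1, GB_eq f hj]
  have h1 := jensen hf a m ha
  have h2 := tail_bound hf.1 a t
  have h3 : PS f (m - a) + 2 * a * f a ≤ PS f a + PS f m := by
    have h4 := jensen0 hf a
    have e3 : PS f (2 * a + 1) = PS f a + PS (fun i => f (a + i)) (a + 1) := by
      rw [← PS_add]; congr 1; ring
    rw [e3, PS_shift] at h4
    have h5 : PS (fun i => f (a + (1 + i))) a ≤ PS (fun i => f (m - a + i)) a :=
      Finset.sum_le_sum (fun i _ => hf.1 (by omega))
    have h6 := PS_add f (m - a) a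
    rw [show m - a + a = m by omega] at h6
    simp only [add_zero] at h4
    nlinarith
  nlinarith [Nat.mul_le_mul_left q h1]

theorem choose_cvx (s : ℕ) : Cvx (fun i => Nat.choose i s) := by
  refine ⟨fun a b h => Nat.choose_le_choose s h, fun i => ?_⟩
  rcases s with _ | s
  · simp
  · have h1 := Nat.choose_succ_succ' (i+1) s
    have h2 := Nat.choose_succ_succ' i s
    have h3 : Nat.choose i s ≤ Nat.choose (i+1) s := Nat.choose_le_choose s (by omega)
    simp only
    have e : i + 2 = i + 1 + 1 := rfl
    rw [e]
    omega

end Cliq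

namespace Cliq
open Classical in
/-- the shift of x to y -/
def shift {V : Type*} (G : SimpleGraph V) (x y : V) : SimpleGraph V where
  Adj a b := a ≠ b ∧ ((a ≠ x ∧ b ≠ x ∧ (G.Adj a b ∨ (a = y ∧ G.Adj x b) ∨ (b = y ∧ G.Adj x a))) ∨
    (a = x ∧ G.Adj x b ∧ (b = y ∨ G.Adj y b)) ∨ (b = x ∧ G.Adj x a ∧ (a = y ∨ G.Adj y a)))
  symm := ⟨by
    intro a b h
    have := G.adj_comm a b
    tauto⟩
  loopless := ⟨by intro a h; exact h.1 rfl⟩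

variable {V : Type*} {G : SimpleGraph V} {x y : V}

theorem shift_y (hxy : G.Adj x y) (b : V) : (shift G x y).Adj y b ↔ b ≠ y ∧ (G.Adj y b ∨ G.Adj x b) := by
  have h1 := hxy.ne
  have h2 := hxy.symm
  have h3 := G.adj_comm
  have h4 : ∀ a, ¬ G.Adj a a := fun a => G.irrefl
  simp only [shift]
  by_cases hb : b = x
  · subst hb; simp_all [eq_comm]
  · simp only [hb]
    constructor
    · rintro ⟨h, h'⟩
      refine ⟨h.symm, ?_⟩
      tauto
    · rintro ⟨h, h'⟩
      refine ⟨h.symm, ?_⟩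
      left
      refine ⟨h1.symm, hb, ?_⟩
      tauto

theorem shift_x (hxy : G.Adj x y) (b : V) : (shift G x y).Adj x b ↔ G.Adj x b ∧ (b = y ∨ G.Adj y b) := by
  have h4 : ∀ a, ¬ G.Adj a a := fun a => G.irrefl
  simp only [shift]
  constructor
  · rintro ⟨h, h'⟩
    have := h.symm
    tauto
  · rintro ⟨h, h'⟩
    refine ⟨h.ne, ?_⟩
    tauto

theorem shift_o {a b : V} (hax : a ≠ x) (hay : a ≠ y) (hbx : b ≠ x) (hby : b ≠ y) :
    (shift G x y).Adj a b ↔ G.Adj a b := by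
  simp only [shift]
  constructor
  · tauto
  · intro h
    exact ⟨h.ne, by tauto⟩

theorem shift_noty (hxy : G.Adj x y) {a b : V} (hay : a ≠ y) (hby : b ≠ y) (h : (shift G x y).Adj a b) :
    G.Adj a b := by
  by_cases hax : a = x
  · subst hax; exact ((shift_x hxy b).1 h).1
  · by_cases hbx : b = x
    · subst hbx; exact ((shift_x hxy a).1 h.symm).1.symm
    · exact (shift_o hax hay hbx hby).1 h

theorem shift_notx (hxy : G.Adj x y) {a b : V} (hax : a ≠ x) (hbx : b ≠ x) (h : G.Adj a b) :
    (shift G x y).Adj a b := by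
  by_cases hay : a = y
  · subst hay; exact (shift_y hxy b).2 ⟨h.ne', .inl h⟩
  · by_cases hby : b = y
    · subst hby; exact ((shift_y hxy a).2 ⟨h.ne, .inl h.symm⟩).symm
    · exact (shift_o hax hay hbx hby).2 h

theorem chain_noty (hxy : G.Adj x y) {l : List V} (h : l.IsChain (shift G x y).Adj) (hy : y ∉ l) :
    l.IsChain G.Adj := by
  refine List.IsChain.imp_of_mem_imp ?_ h
  intro a b ha hb hab
  exact shift_noty hxy (fun e => hy (e ▸ ha)) (fun e => hy (e ▸ hb)) hab

theorem chain_rev {l : List V} (h : l.IsChain G.Adj) : l.reverse.IsChain G.Adj := by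
  rw [List.isChain_reverse]
  exact h.imp (fun a b hab => hab.symm)

theorem glast {V : Type*} (a z v : V) (L Q : List V) (h : v ≠ z) :
    (a :: (L ++ z :: Q)).getLast? = some v ↔ Q.getLast? = some v := by
  rw [← List.cons_append, List.getLast?_append]
  cases Q <;> simp [h.symm]

theorem ghead {V : Type*} (z : V) (L Q : List V) (h : L ≠ []) :
    (L.reverse ++ z :: Q).head? = L.getLast? := by
  rw [List.head?_append]
  cases hL : L.getLast? with
  | none => simp at hL; exact absurd hL h
  | some w => simp [hL]

theorem path_core (hxy : G.Adj x y) (P Q : List V) (hc : (P ++ y :: Q).IsChain (shift G x y).Adj)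
    (hnd : (P ++ y :: Q).Nodup) (hxP : x ∉ P) :
    ∃ R : List V, (P ++ R).IsChain G.Adj ∧ (P ++ R).Nodup ∧ (∀ a ∈ R, a = x ∨ a = y ∨ a ∈ Q) ∧
      Q.length + 1 ≤ R.length ∧ (P = [] → R.head? = some y) ∧
      (∀ v, v ≠ x → v ≠ y → (y :: Q).getLast? = some v → R.getLast? = some v) := by
  have hne := hxy.ne
  have hyP : y ∉ P := by
    intro h; simp [List.nodup_append] at hnd; exact (hnd.2.2 y h).1 rfl
  have hyQ : y ∉ Q := by
    intro h; simp [List.nodup_append] at hnd; tauto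
  have hcP := chain_noty hxy (List.isChain_append.1 hc).1 hyP
  have hcP2 := (List.isChain_append.1 hc).2.2
  have hcQ0 := (List.isChain_append.1 hc).2.1
  rw [List.isChain_cons] at hcQ0
  have hPy : ∀ a ∈ P.getLast?, G.Adj a y ∨ G.Adj a x := by
    intro a ha
    have := hcP2 a ha y (by simp)
    rw [SimpleGraph.adj_comm, shift_y hxy] at this
    simpa [G.adj_comm] using this.2
  have hQy : ∀ a ∈ Q.head?, G.Adj y a ∨ G.Adj x a := by
    intro a ha
    have := hcQ0.1 a ha
    rw [shift_y hxy] at this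
    exact this.2
  have hxx : ∀ b, (shift G x y).Adj x b → b ≠ y → G.Adj x b ∧ G.Adj y b := by
    intro b hb hby
    have := (shift_x hxy b).1 hb
    tauto
  by_cases hxQ : x ∈ Q
  · obtain ⟨Q1, Q2, rfl⟩ := List.append_of_mem hxQ
    have hc1 := (List.isChain_append.1 hcQ0.2).1
    have hc2 := (List.isChain_append.1 hcQ0.2).2.1
    have hc3 := (List.isChain_append.1 hcQ0.2).2.2
    have hyQ1 : y ∉ Q1 := fun h => hyQ (by simp [h])
    have hyQ2 : y ∉ Q2 := fun h => hyQ (by simp [h])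
    have d1 := chain_noty hxy hc1 hyQ1
    rw [List.isChain_cons] at hc2
    have d2 := chain_noty hxy hc2.2 hyQ2
    have e2 : ∀ b ∈ Q2.head?, G.Adj x b ∧ G.Adj y b := fun b hb =>
      hxx b (hc2.1 b hb) (fun e => hyQ2 (e ▸ List.mem_of_mem_head? hb))
    have e1 : ∀ b ∈ Q1.getLast?, G.Adj x b ∧ G.Adj y b := fun b hb =>
      hxx b (hc3 b hb x (by simp)).symm (fun e => hyQ1 (e ▸ List.mem_of_getLast? hb))
    have d1r := chain_rev d1
    have hyx := hxy.symm
    have hsy := G.adj_comm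
    by_cases gP : ∀ a ∈ P.getLast?, G.Adj a y
    · by_cases gQ : ∀ b ∈ (Q1 ++ x :: Q2).head?, G.Adj y b
      · refine ⟨y :: (Q1 ++ x :: Q2), ?_, hnd, by grind, by simp, by simp, by simp⟩
        simp only [List.isChain_append, List.isChain_cons]
        refine ⟨hcP, ⟨gQ, d1, ⟨fun b hb => (e2 b hb).1, d2⟩, ?_⟩, ?_⟩
        · intro a ha b hb; simp at hb; subst hb; exact (e1 a ha).1.symm
        · intro a ha b hb; simp at hb; subst hb; exact gP a ha
      · have hQ1 : Q1 ≠ [] := by rintro rfl; simp [hyx] at gQ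
        refine ⟨y :: (Q1.reverse ++ x :: Q2), ?_, ?_, ?_, ?_, by grind, ?_⟩
        · simp only [List.isChain_append, List.isChain_cons]
          refine ⟨hcP, ⟨?_, d1r, ⟨fun b hb => (e2 b hb).1, d2⟩, ?_⟩, ?_⟩
          · intro b hb
            exact (e1 b (by rwa [ghead _ _ _ hQ1] at hb)).2
          · intro a ha b hb; simp at hb; subst hb
            have ha' : a ∈ (Q1 ++ x :: Q2).head? := by
              simp at ha; simp [ha]
            have := hQy a ha'
            push Not at gQ
            obtain ⟨b', hb', hb2⟩ := gQ
            have : b' = a := by rw [Option.mem_def] at *; rw [ha'] at hb'; simpa using hb'.symm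
            subst this
            rw [hsy]; tauto
          · intro a ha b hb; simp at hb; subst hb; exact gP a ha
        · simp [List.nodup_append] at hnd ⊢; grind
        · grind
        · simp
        · intro v h1 h2; rw [glast _ _ _ _ _ h1, glast _ _ _ _ _ h1]; exact id
    · have hP : P ≠ [] := by rintro rfl; simp at gP
      have gP' : ∀ a ∈ P.getLast?, G.Adj a x := by
        push Not at gP
        obtain ⟨b', hb', hb2⟩ := gP
        intro a ha
        have : b' = a := by rw [Option.mem_def] at *; rw [ha] at hb'; simpa using hb'.symm
        subst this
        have := hPy b' hb'
        tauto
      by_cases hQ1 : Q1 = []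
      · subst hQ1
        refine ⟨x :: y :: Q2, ?_, ?_, by grind, by simp, by simp [hP], ?_⟩
        · simp only [List.isChain_append, List.isChain_cons]
          refine ⟨hcP, ⟨by simpa using hxy, fun b hb => (e2 b hb).2, d2⟩, by simpa using gP'⟩
        · simp [List.nodup_append] at hnd ⊢; grind
        · intro v h1 h2; cases Q2 <;> simp [h1.symm, h2.symm]
      have hl : ∀ (L : List V) (v : V), v ≠ x → v ≠ y → (y :: (Q1 ++ x :: Q2)).getLast? = some v →
          (x :: (L ++ y :: Q2)).getLast? = some v := by
        intro L v h1 h2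
        rw [glast _ _ _ _ _ h1, glast _ _ _ _ _ h2]; exact id
      by_cases gQ : ∀ b ∈ Q1.head?, G.Adj y b
      · refine ⟨x :: (Q1.reverse ++ y :: Q2), ?_, ?_, ?_, by grind, by simp [hP], ?_⟩
        · simp only [List.isChain_append, List.isChain_cons]
          refine ⟨hcP, ⟨?_, d1r, ⟨fun b hb => (e2 b hb).2, d2⟩, ?_⟩, ?_⟩
          · intro b hb
            exact (e1 b (by rwa [ghead _ _ _ hQ1] at hb)).1
          · intro a ha b hb; simp at hb; subst hb
            exact (gQ a (by simpa using ha)).symm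
          · intro a ha b hb; simp at hb; subst hb; exact gP' a ha
        · simp [List.nodup_append] at hnd ⊢; grind
        · simp; grind
        · exact hl _
      · refine ⟨x :: (Q1 ++ y :: Q2), ?_, ?_, ?_, by grind, by simp [hP], ?_⟩
        · simp only [List.isChain_append, List.isChain_cons]
          refine ⟨hcP, ⟨?_, d1, ⟨fun b hb => (e2 b hb).2, d2⟩, ?_⟩, ?_⟩
          · intro a ha
            have ha2 : a ∈ Q1.head? := by
              cases Q1 <;> simp_all
            have := hQy a (by cases Q1 <;> simp_all)
            push Not at gQ
            obtain ⟨b', hb', hb2⟩ := gQ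
            have : b' = a := by rw [Option.mem_def] at *; rw [ha2] at hb'; simpa using hb'.symm
            subst this
            tauto
          · intro a ha b hb; simp at hb; subst hb
            exact (e1 a ha).2.symm
          · intro a ha b hb; simp at hb; subst hb; exact gP' a ha
        · simp [List.nodup_append] at hnd ⊢; grind
        · simp; grind
        · exact hl _
  · have hcQ := chain_noty hxy hcQ0.2 hyQ
    have hyx := hxy.symm
    have hlast : ∀ v, v ≠ y → (y :: Q).getLast? = some v → Q ≠ [] ∧ Q.getLast? = some v := by
      intro v hv h
      cases Q <;> simp_all
    have hQx : ¬ (∀ b ∈ Q.head?, G.Adj y b) → ∀ b ∈ Q.head?, G.Adj x b := by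
      intro gQ a ha
      push Not at gQ
      obtain ⟨b', hb', hb2⟩ := gQ
      have : b' = a := by rw [Option.mem_def] at *; rw [ha] at hb'; simpa using hb'.symm
      subst this
      have := hQy b' hb'
      tauto
    have hPx : ¬ (∀ b ∈ P.getLast?, G.Adj b y) → ∀ b ∈ P.getLast?, G.Adj b x := by
      intro gQ a ha
      push Not at gQ
      obtain ⟨b', hb', hb2⟩ := gQ
      have : b' = a := by rw [Option.mem_def] at *; rw [ha] at hb'; simpa using hb'.symm
      subst this
      have := hPy b' hb'
      tauto
    by_cases gP : ∀ a ∈ P.getLast?, G.Adj a y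
    · by_cases gQ : ∀ b ∈ Q.head?, G.Adj y b
      · refine ⟨y :: Q, ?_, hnd, by grind, by simp, by simp, by simp⟩
        simp only [List.isChain_append, List.isChain_cons]
        exact ⟨hcP, ⟨gQ, hcQ⟩, by simpa using gP⟩
      · refine ⟨y :: x :: Q, ?_, ?_, by grind, by simp, by simp, ?_⟩
        · simp only [List.isChain_append, List.isChain_cons]
          exact ⟨hcP, ⟨by simpa using hyx, hQx gQ, hcQ⟩, by simpa using gP⟩
        · simp [List.nodup_append] at hnd ⊢; grind
        · intro v h1 h2 h3
          have := hlast v h2 h3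
          cases Q <;> simp_all
    · have hP : P ≠ [] := by rintro rfl; simp at gP
      by_cases gQ : ∀ b ∈ Q.head?, G.Adj y b
      · refine ⟨x :: y :: Q, ?_, ?_, by grind, by simp, by simp [hP], ?_⟩
        · simp only [List.isChain_append, List.isChain_cons]
          exact ⟨hcP, ⟨by simpa using hxy, gQ, hcQ⟩, by simpa using hPx gP⟩
        · simp [List.nodup_append] at hnd ⊢; grind
        · intro v h1 h2 h3
          have := hlast v h2 h3
          cases Q <;> simp_all
      · refine ⟨x :: Q, ?_, ?_, by simp; grind, by simp, by simp [hP], ?_⟩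
        · simp only [List.isChain_append, List.isChain_cons]
          exact ⟨hcP, ⟨hQx gQ, hcQ⟩, by simpa using hPx gP⟩
        · simp [List.nodup_append] at hnd ⊢; grind
        · intro v h1 h2 h3
          have := hlast v h2 h3
          cases Q <;> simp_all
end Cliq

namespace Cliq
open Finset
variable {V : Type*} {G : SimpleGraph V} {x y : V}

/-- all paths inside S have at most m vertices -/
def PB (G : SimpleGraph V) (S : Finset V) (m : ℕ) : Prop :=
  ∀ l : List V, l.Nodup → l.IsChain G.Adj → (∀ a ∈ l, a ∈ S) → l.length ≤ m

/-- all u-v paths inside S have at most m vertices -/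
def UV (G : SimpleGraph V) (S : Finset V) (u v : V) (m : ℕ) : Prop :=
  ∀ l : List V, l.Nodup → l.IsChain G.Adj → (∀ a ∈ l, a ∈ S) → l.head? = some u →
    l.getLast? = some v → l.length ≤ m

theorem PB.mono {S T : Finset V} {m : ℕ} (h : PB G S m) (hT : T ⊆ S) : PB G T m :=
  fun l h1 h2 h3 => h l h1 h2 (fun a ha => hT (h3 a ha))

theorem UV.symm {S : Finset V} {u v : V} {m : ℕ} (h : UV G S u v m) : UV G S v u m := by
  intro l h1 h2 h3 h4 h5
  have := h l.reverse (by simpa using h1) (chain_rev h2) (by simpa using h3) (by simpa using h5)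
    (by simpa using h4)
  simpa using this

theorem shift_PB {S : Finset V} {m : ℕ} (hxy : G.Adj x y) (hx : x ∈ S) (hy : y ∈ S) (h : PB G S m) :
    PB (shift G x y) S m := by
  have key : ∀ P Q : List V, (P ++ y :: Q).IsChain (shift G x y).Adj → (P ++ y :: Q).Nodup →
      (∀ a ∈ P ++ y :: Q, a ∈ S) → x ∉ P → (P ++ y :: Q).length ≤ m := by
    intro P Q h1 h2 h3 h4
    obtain ⟨R, r1, r2, r3, r4, -⟩ := path_core hxy P Q h1 h2 h4
    have := h _ r2 r1 (by
      intro a ha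
      simp at ha h3
      rcases ha with ha | ha
      · exact h3 a (.inl ha)
      · rcases r3 a ha with rfl | rfl | h
        · exact hx
        · exact hy
        · exact h3 a (.inr (.inr h)))
    simp at *
    omega
  intro l h1 h2 h3
  by_cases hyl : y ∈ l
  · obtain ⟨P, Q, rfl⟩ := List.append_of_mem hyl
    by_cases hxP : x ∈ P
    · have := key Q.reverse P.reverse (by simpa using chain_rev h2)
        (by have := List.nodup_reverse.2 h1; simpa using this)
        (by intro a ha; apply h3; simp at *; tauto)
        (by simp [List.nodup_append] at h1 ⊢; intro h; exact (h1.2.2 x hxP).2 x h rfl)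
      simp at *
      omega
    · exact key P Q h2 h1 h3 hxP
  · exact h l h1 (chain_noty hxy h2 hyl) h3

theorem shift_UV {S : Finset V} {u v : V} {m : ℕ} (hxu : G.Adj x u) (hx : x ∈ S) (hu : u ∈ S)
    (hvx : v ≠ x) (hvu : v ≠ u) (h : UV G S u v m) : UV (shift G x u) S u v m := by
  intro l h1 h2 h3 h4 h5
  cases l with
  | nil => simp at h4
  | cons a Q =>
    simp at h4; subst h4
    obtain ⟨R, r1, r2, r3, r4, r5, r6⟩ := path_core hxu [] Q h2 h1 (by simp)
    have := h R r2 r1 (by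
      intro a ha
      rcases r3 a ha with rfl | rfl | h
      · exact hx
      · exact hu
      · exact h3 a (by simp [h])) (r5 rfl) (r6 v hvx hvu h5)
    simp; omega

/-- connectedness through cuts -/
def Conn (G : SimpleGraph V) (S : Finset V) : Prop :=
  ∀ A ⊆ S, A.Nonempty → A ≠ S → ∃ a ∈ A, ∃ b ∈ S, b ∉ A ∧ G.Adj a b

theorem conn_anchor {S : Finset V} (r : V) (hr : r ∈ S)
    (h : ∀ B ⊆ S, B.Nonempty → r ∉ B → ∃ a ∈ B, ∃ b ∈ S, b ∉ B ∧ G.Adj a b) : Conn G S := by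
  classical
  intro A hA hne hneq
  by_cases hrA : r ∈ A
  · obtain ⟨a, ha, b, hb, hab, hadj⟩ := h (S \ A) sdiff_subset
      (by rw [sdiff_nonempty]; intro h'; exact hneq (hA.antisymm h')) (by simp [hrA])
    simp at ha hab
    exact ⟨b, hab hb, a, ha.1, ha.2, hadj.symm⟩
  · exact h A hA hne hrA

theorem conn_shift {S : Finset V} (hxy : G.Adj x y) (hx : x ∈ S) (hy : y ∈ S) (h : Conn G S) :
    Conn (shift G x y) S := by
  refine conn_anchor y hy ?_
  intro B hB hne hyB
  by_cases hxB : x ∈ B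
  · exact ⟨x, hxB, y, hy, hyB, (shift_x hxy y).2 ⟨hxy, .inl rfl⟩⟩
  · obtain ⟨a, ha, b, hb, hab, hadj⟩ := h B hB hne (by rintro rfl; exact hyB hy)
    have hay : a ≠ y := by rintro rfl; exact hyB ha
    have hax : a ≠ x := by rintro rfl; exact hxB ha
    by_cases hbx : b = x
    · subst hbx
      exact ⟨a, ha, y, hy, hyB, ((shift_y hxy a).2 ⟨hay, .inr hadj.symm⟩).symm⟩
    · exact ⟨a, ha, b, hb, hab, shift_notx hxy hax hbx hadj⟩

/-- weight of a clique of size j -/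
def fc (s c j : ℕ) : ℕ := if j ≤ s then Nat.choose c (s - j) else 0

theorem fc_add (s c j : ℕ) : fc s c j + fc s c (j + 1) = fc s (c + 1) j := by
  unfold fc
  by_cases h : j + 1 ≤ s
  · rw [if_pos (by omega), if_pos h, if_pos (by omega)]
    obtain ⟨d, rfl⟩ := Nat.exists_eq_add_of_le h
    rw [show j + 1 + d - j = d + 1 by omega, show j + 1 + d - (j + 1) = d by omega,
      Nat.choose_succ_succ']
    omega
  · rw [if_neg h]
    by_cases h2 : j ≤ s
    · rw [if_pos h2, if_pos h2, show s - j = 0 by omega]; simp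
    · simp [h2]

/-- nonempty cliques -/
def Cl (G : SimpleGraph V) (K : Finset V) : Prop := K.Nonempty ∧ G.IsClique (K : Set V)

open Classical in
/-- weighted clique count -/
noncomputable def W (s c : ℕ) (G : SimpleGraph V) (S : Finset V) : ℕ :=
  ∑ K ∈ S.powerset, if Cl G K then fc s c K.card else 0

theorem W_remove [DecidableEq V] {s c : ℕ} (hs : 1 ≤ s) {S : Finset V} {r : V} (hr : r ∈ S) :
    W s c G S ≤ Nat.choose c (s - 1) + W s (c + 1) G (S.erase r) := by
  classical
  obtain ⟨T, hT, rfl⟩ : ∃ T, r ∉ T ∧ S = insert r T := ⟨S.erase r, by simp, by simp [hr]⟩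
  rw [erase_insert hT]
  unfold W
  rw [sum_powerset_insert hT]
  have h1 : ∑ t ∈ T.powerset, (if Cl G (insert r t) then fc s c (insert r t).card else 0) ≤
      ∑ t ∈ T.powerset, ((if Cl G t then fc s c (t.card + 1) else 0) +
        if t = ∅ then fc s c 1 else 0) := by
    refine sum_le_sum (fun t ht => ?_)
    have hrt : r ∉ t := fun h => hT (mem_powerset.1 ht h)
    rw [card_insert_of_notMem hrt]
    by_cases h0 : t = ∅
    · subst h0
      simp only [insert_empty_eq, card_empty, zero_add, if_true]
      split_ifs <;> omega
    · have hne : t.Nonempty := nonempty_iff_ne_empty.2 h0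
      by_cases hc : Cl G (insert r t)
      · have : Cl G t := ⟨hne, hc.2.subset (by simp)⟩
        rw [if_pos hc, if_pos this]; omega
      · rw [if_neg hc]; omega
  rw [sum_add_distrib] at h1
  have h2 : ∑ t ∈ T.powerset, (if t = ∅ then fc s c 1 else 0) = Nat.choose c (s - 1) := by
    simp [fc, hs]
  rw [h2] at h1
  have h3 : ∑ K ∈ T.powerset, (if Cl G K then fc s (c+1) K.card else 0)
      = ∑ t ∈ T.powerset, (if Cl G t then fc s c t.card else 0) +
        ∑ t ∈ T.powerset, (if Cl G t then fc s c (t.card + 1) else 0) := by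
    rw [← sum_add_distrib]
    refine sum_congr rfl (fun t _ => ?_)
    split_ifs
    · rw [fc_add]
    · rfl
  omega

theorem W_pendant [DecidableEq V] {s : ℕ} (hs : 2 ≤ s) {S : Finset V} {r u : V} (hr : r ∈ S)
    (hu : ∀ b ∈ S, G.Adj r b → b = u) :
    W s 0 G S ≤ W s 0 G (S.erase r) + Nat.choose 0 (s - 2) := by
  classical
  obtain ⟨T, hT, rfl⟩ : ∃ T, r ∉ T ∧ S = insert r T := ⟨S.erase r, by simp, by simp [hr]⟩
  rw [erase_insert hT]
  unfold W
  rw [sum_powerset_insert hT]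
  refine Nat.add_le_add_left ?_ _
  calc _ ≤ ∑ t ∈ T.powerset, (if t = {u} then Nat.choose 0 (s - 2) else 0) := by
        refine sum_le_sum (fun t ht => ?_)
        have hrt : r ∉ t := fun h => hT (mem_powerset.1 ht h)
        rw [card_insert_of_notMem hrt]
        by_cases hc : Cl G (insert r t)
        · have ht1 : t ⊆ {u} := by
            intro b hb
            have hrb : r ≠ b := by rintro rfl; exact hrt hb
            have := hc.2 (by simp : r ∈ _) (by simp [hb] : b ∈ _) hrb
            simp [hu b (mem_insert_of_mem (mem_powerset.1 ht hb)) this]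
          rcases subset_singleton_iff.1 ht1 with rfl | rfl
          · have : fc s 0 1 = 0 := by
              simp only [fc]; split_ifs
              · rw [Nat.choose_eq_zero_iff]; omega
              · rfl
            simp [this]
          · rw [if_pos hc]; simp [fc, hs]
        · rw [if_neg hc]; omega
    _ ≤ _ := by
        rw [sum_ite_eq']
        split_ifs <;> simp

theorem W_split {s c : ℕ} [DecidableEq V] {A B : Finset V} 
    (hno : ∀ a ∈ A, ∀ b ∈ B, ¬ G.Adj a b) :
    W s c G (A ∪ B) ≤ W s c G A + W s c G B := by
  classical
  unfold W
  rw [← sum_filter, ← sum_filter, ← sum_filter]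
  have hsub : (A ∪ B).powerset.filter (fun K => Cl G K) ⊆
      A.powerset.filter (fun K => Cl G K) ∪
      B.powerset.filter (fun K => Cl G K) := by
    intro K hK
    simp only [mem_filter, mem_powerset, mem_union] at *
    obtain ⟨h1, h2, h3⟩ := hK
    by_cases hA : K ⊆ A
    · exact .inl ⟨hA, h2, h3⟩
    · right
      refine ⟨?_, h2, h3⟩
      obtain ⟨b, hb, hbA⟩ := not_subset.1 hA
      have hbB : b ∈ B := by have := h1 hb; simp at this; tauto
      intro a ha
      by_contra haB
      have haA : a ∈ A := by have := h1 ha; simp at this; tauto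
      have : a ≠ b := by rintro rfl; exact hbA haA
      exact hno a haA b hbB (h3 ha hb this)
  refine (sum_le_sum_of_subset hsub).trans ?_
  rw [← sum_union_inter]
  exact Nat.le_add_right _ _

theorem W_full [DecidableEq V] {s : ℕ} (hs : 1 ≤ s) (S : Finset V) (c : ℕ) :
    W s c G S ≤ PS (fun i => Nat.choose (c + i) (s - 1)) S.card := by
  induction S using Finset.induction_on generalizing c with
  | empty =>
    simp [W, PS]
    exact fun h => absurd h.1 (by simp)
  | insert r T hr ih =>
    rw [card_insert_of_notMem hr, PS_shift]
    have h1 := W_remove (G := G) (c := c) hs (mem_insert_self r T)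
    rw [erase_insert hr] at h1
    have h2 := ih (c + 1)
    simp only [add_zero, ← add_assoc]
    omega

theorem W_transfer {s c : ℕ} {G' : SimpleGraph V} {S : Finset V} (i : Finset V → Finset V)
    (hi : ∀ K ⊆ S, G.IsClique (K : Set V) → i K ⊆ S ∧ G'.IsClique (i K : Set V) ∧ (i K).card = K.card)
    (hinj : ∀ K ⊆ S, G.IsClique (K : Set V) → ∀ L ⊆ S, G.IsClique (L : Set V) → i K = i L → K = L) :
    W s c G S ≤ W s c G' S := by
  classical
  unfold W
  rw [← sum_filter, ← sum_filter]
  set A : Finset (Finset V) := S.powerset.filter (fun K => Cl G K) with hA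
  have hAm : ∀ K ∈ A, K ⊆ S ∧ K.Nonempty ∧ G.IsClique (K : Set V) := by
    intro K hK; exact ⟨mem_powerset.1 (mem_filter.1 hK).1, (mem_filter.1 hK).2⟩
  have h1 : ∑ K ∈ A, fc s c K.card = ∑ K ∈ A.image i, fc s c K.card := by
    rw [sum_image]
    · exact sum_congr rfl (fun K hK => by rw [(hi K (hAm K hK).1 (hAm K hK).2.2).2.2])
    · intro K hK L hL h
      exact hinj K (hAm K hK).1 (hAm K hK).2.2 L (hAm L hL).1 (hAm L hL).2.2 h
  rw [h1]
  refine sum_le_sum_of_subset ?_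
  intro L hL
  obtain ⟨K, hK, rfl⟩ := mem_image.1 hL
  have h2 := hi K (hAm K hK).1 (hAm K hK).2.2
  rw [mem_filter, mem_powerset]
  refine ⟨h2.1, ?_, h2.2.1⟩
  rw [← card_pos, h2.2.2, card_pos]
  exact (hAm K hK).2.1

theorem W_shift {s c : ℕ} {S : Finset V} (hxy : G.Adj x y) (hy : y ∈ S) :
    W s c G S ≤ W s c (shift G x y) S := by
  classical
  have bad : ∀ K : Finset V, G.IsClique (K : Set V) → ¬ (shift G x y).IsClique (K : Set V) →
      x ∈ K ∧ y ∉ K ∧ ∃ b ∈ K, b ≠ y ∧ ¬ G.Adj y b := by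
    intro K h1 h2
    rw [SimpleGraph.isClique_iff, Set.Pairwise] at h2
    push Not at h2
    obtain ⟨a, ha, b, hb, hab, h⟩ := h2
    have hadj := h1 ha hb hab
    have hxb : ∀ b, b ∈ K → x ∈ K → G.Adj x b → ¬ (shift G x y).Adj x b → 
        x ∈ K ∧ y ∉ K ∧ ∃ b ∈ K, b ≠ y ∧ ¬ G.Adj y b := by
      intro b hb hx h3 h4
      rw [shift_x hxy] at h4
      have h5 : b ≠ y ∧ ¬ G.Adj y b := by tauto
      refine ⟨hx, ?_, b, hb, h5⟩
      intro hyK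
      exact h5.2 (h1 hyK hb h5.1.symm)
    by_cases hax : a = x
    · subst hax
      exact hxb b hb ha hadj h
    · by_cases hbx : b = x
      · subst hbx
        exact hxb a ha hb hadj.symm (fun h' => h h'.symm)
      · exact absurd (shift_notx hxy hax hbx hadj) h
  refine W_transfer (fun K => if (shift G x y).IsClique (K : Set V) then K else insert y (K.erase x)) ?_ ?_
  · intro K hKS hK
    beta_reduce
    split_ifs with h
    · exact ⟨hKS, h, rfl⟩
    · obtain ⟨hx, hyK, -⟩ := bad K hK h
      refine ⟨?_, ?_, ?_⟩
      · intro a ha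
        simp at ha
        rcases ha with rfl | ha
        · exact hy
        · exact hKS ha.2
      · have hyb : ∀ b ∈ K, b ≠ x → (shift G x y).Adj y b := by
          intro b hb hbx
          exact (shift_y hxy b).2 ⟨fun e => hyK (e ▸ hb), .inr (hK hx hb hbx.symm)⟩
        intro a ha b hb hab
        simp at ha hb
        rcases ha with rfl | ha
        · rcases hb with rfl | hb
          · exact absurd rfl hab
          · exact hyb b hb.1 hb.2
        · rcases hb with rfl | hb
          · exact (hyb a ha.1 ha.2).symm
          · exact shift_notx hxy ha.2 hb.2 (hK ha.1 hb.1 hab)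
      · rw [card_insert_of_notMem (by simp [hyK]), card_erase_of_mem hx]
        have := card_pos.2 ⟨x, hx⟩
        omega
  · intro K hKS hK L hLS hL
    have mix : ∀ K L : Finset V, G.IsClique (K : Set V) → G.IsClique (L : Set V) →
        ¬ (shift G x y).IsClique (L : Set V) → K ≠ insert y (L.erase x) := by
      rintro K L hK hL h rfl
      obtain ⟨hx, hyK, b, hb, hby, hb2⟩ := bad L hL h
      have hbx : b ≠ x := by rintro rfl; exact hb2 hxy.symm
      exact hb2 (hK (by simp : y ∈ _) (by simp [hb, hbx] : b ∈ _) hby.symm)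
    beta_reduce
    split_ifs with h1 h2 h2
    · exact id
    · intro h; exact absurd h (mix K L hK hL h2)
    · intro h; exact absurd h.symm (mix L K hL hK h1)
    · intro h
      obtain ⟨hx, hyK, -⟩ := bad K hK h1
      obtain ⟨hx', hyL, -⟩ := bad L hL h2
      ext a
      have := congrArg (fun s => a ∈ s) h
      simp at this
      by_cases hay : a = y
      · subst hay; simp [hyK, hyL]
      · by_cases hax : a = x
        · subst hax; simp [hx, hx']
        · simpa [hay, hax] using this

theorem W_zero [Fintype V] {s : ℕ} (hs : 1 ≤ s) : (G.cliqueSet s).ncard ≤ W s 0 G univ := by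
  classical
  unfold W
  rw [← sum_filter]
  have h1 : G.cliqueSet s = ((univ.powerset.filter (fun K : Finset V => Cl G K)).filter
      (fun K => K.card = s) : Finset (Finset V)) := by
    ext K
    simp only [SimpleGraph.mem_cliqueSet_iff, SimpleGraph.isNClique_iff, coe_filter, mem_filter, Cl,
      Set.mem_ofPred_eq, powerset_univ, mem_univ, true_and]
    constructor
    · rintro ⟨h, h2⟩
      refine ⟨⟨?_, h⟩, h2⟩
      rw [← card_pos]; omega
    · tauto
  rw [h1, Set.ncard_coe_finset, card_eq_sum_ones]
  refine le_trans ?_ (sum_le_sum_of_subset (filter_subset (fun K => K.card = s) _))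
  refine sum_le_sum (fun K hK => ?_)
  have := (mem_filter.1 hK).2
  simp [fc, this]

end Cliq

namespace Cliq
open Finset
variable {V : Type*} {G : SimpleGraph V} {x y : V}

theorem dominate {s c m : ℕ} {S : Finset V} (hy : y ∈ S) (hC : Conn G S) (hP : PB G S m) :
    ∃ G' : SimpleGraph V, Conn G' S ∧ PB G' S m ∧ W s c G S ≤ W s c G' S ∧
      ∀ b ∈ S, b ≠ y → G'.Adj y b := by
  classical
  induction hd : (S.filter (fun b => b ≠ y ∧ ¬ G.Adj y b)).card using Nat.strong_induction_on
    generalizing G with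
  | _ d ih =>
  by_cases hA : S.filter (fun b => b = y ∨ G.Adj y b) = S
  · refine ⟨G, hC, hP, le_rfl, fun b hb hby => ?_⟩
    rw [← hA] at hb
    have := (mem_filter.1 hb).2
    tauto
  · obtain ⟨a, ha, b, hb, hab, hadj⟩ := hC _ (filter_subset _ _) ⟨y, by simp [hy]⟩ hA
    simp only [mem_filter, not_and, not_or] at ha hab
    have hab := hab hb
    have hay : a ≠ y := by rintro rfl; exact hab.2 hadj
    have hya : G.Adj y a := by tauto
    have hxy := hya.symm
    have hlt : (S.filter (fun b => b ≠ y ∧ ¬ (shift G a y).Adj y b)).card < d := by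
      rw [← hd]
      refine card_lt_card ?_
      rw [ssubset_iff_of_subset]
      · refine ⟨b, by simp [hb, hab], ?_⟩
        simp only [mem_filter, not_and, not_not]
        intro _ h
        exact (shift_y hxy b).2 ⟨h, .inr hadj⟩
      · intro z hz
        simp only [mem_filter] at hz ⊢
        refine ⟨hz.1, hz.2.1, fun h => hz.2.2 ((shift_y hxy z).2 ⟨hz.2.1, .inl h⟩)⟩
    obtain ⟨G', h1, h2, h3, h4⟩ := ih _ hlt (conn_shift hxy ha.1 hy hC) (shift_PB hxy ha.1 hy hP) rfl
    exact ⟨G', h1, h2, (W_shift hxy hy).trans h3, h4⟩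

theorem chain_side {A B : Finset V} (h : ∀ a ∈ A, ∀ b ∈ B, b ∉ A → ¬ G.Adj a b) (hAB : A ⊆ B)
    (l : List V) (hl : l.IsChain G.Adj) (hB : ∀ a ∈ l, a ∈ B) :
    (∀ a ∈ l, a ∈ A) ∨ (∀ a ∈ l, a ∉ A) := by
  induction l with
  | nil => simp
  | cons a l ih =>
    cases l with
    | nil => simp; exact em _
    | cons b l =>
      have h1 : G.Adj a b := by simp at hl; exact hl.1
      have h2 := ih (by simp at hl; exact hl.2) (fun c hc => hB c (by simp at hc ⊢; tauto))
      have ha := hB a (by simp)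
      have hb := hB b (by simp)
      rcases h2 with h2 | h2
      · left
        intro c hc
        rcases List.mem_cons.1 hc with rfl | hc
        · by_contra hcA
          exact h b (h2 b (by simp)) c ha hcA h1.symm
        · exact h2 c hc
      · right
        intro c hc
        rcases List.mem_cons.1 hc with rfl | hc
        · intro hcA
          exact h c hcA b hb (h2 b (by simp)) h1
        · exact h2 c hc

theorem comp_of_path {S : Finset V} {l : List V} (hl : l.IsChain G.Adj) (hS : ∀ a ∈ l, a ∈ S)
    (hne : l ≠ []) :
    ∃ B ⊆ S, (∀ a ∈ l, a ∈ B) ∧ Conn G B ∧ ∀ a ∈ B, ∀ b ∈ S, b ∉ B → ¬ G.Adj a b := by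
  classical
  obtain ⟨B, hB, hmin⟩ := exists_min_image
    (S.powerset.filter (fun B => (∀ a ∈ l, a ∈ B) ∧ ∀ a ∈ B, ∀ b ∈ S, b ∉ B → ¬ G.Adj a b)) card
    ⟨S, by
      simp only [mem_filter, mem_powerset]
      exact ⟨Subset.refl _, hS, fun a _ b hb hb' => absurd hb hb'⟩⟩
  simp only [mem_filter, mem_powerset] at hB hmin
  refine ⟨B, hB.1, hB.2.1, ?_, hB.2.2⟩
  intro A hA hAne hAB
  by_contra hcon
  push Not at hcon
  rcases chain_side hcon hA l hl hB.2.1 with h | h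
  · have := hmin A ⟨hA.trans hB.1, h, ?_⟩
    · exact hAB (eq_of_subset_of_card_le hA this)
    · intro a ha b hb hbA
      by_cases hbB : b ∈ B
      · exact hcon a ha b hbB hbA
      · exact hB.2.2 a (hA ha) b hb hbB
  · have := hmin (B \ A) ⟨sdiff_subset.trans hB.1, fun a ha => by simp [h a ha, hB.2.1 a ha], ?_⟩
    · rw [card_sdiff_of_subset hA] at this
      have h1 := card_pos.2 hAne
      have h2 := card_le_card hA
      omega
    · intro a ha b hb hbA hadj
      simp at ha hbA
      by_cases hbB : b ∈ B
      · exact hcon b (hbA hbB) a ha.1 ha.2 hadj.symm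
      · exact hB.2.2 a ha.1 b hb hbB hadj

/-- not connected means splittable -/
theorem not_conn [DecidableEq V] {S : Finset V} (h : ¬ Conn G S) :
    ∃ A B : Finset V, S = A ∪ B ∧ Disjoint A B ∧ A.Nonempty ∧ B.Nonempty ∧
      ∀ a ∈ A, ∀ b ∈ B, ¬ G.Adj a b := by
  unfold Conn at h
  push Not at h
  obtain ⟨A, hA, hne, hAS, h⟩ := h
  refine ⟨A, S \ A, by simp [hA], disjoint_sdiff, hne, ?_, ?_⟩
  · rw [sdiff_nonempty]; intro h'; exact hAS (hA.antisymm h')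
  · intro a ha b hb
    simp at hb
    exact h a ha b hb.1 hb.2

/-- the statement of the main estimate for one set -/
def MainFor (s : ℕ) (G : SimpleGraph V) (S : Finset V) : Prop :=
  ∀ c m, Conn G S → PB G S m → m < S.card → ∃ a, 1 ≤ a ∧ 2 * a + 1 ≤ m ∧
    W s c G S ≤ PS (fun i => Nat.choose (c + i) (s - 1)) (m - a) +
      (S.card - m + a) * Nat.choose (c + a) (s - 1)

theorem avg {s : ℕ} (hs : 1 ≤ s) {N : ℕ} (hM : ∀ S : Finset V, S.card < N → MainFor s G S)
    (c y : ℕ) (S : Finset V) (hN : S.card < N) (hP : PB G S y) :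
    y * W s c G S ≤ S.card * PS (fun i => Nat.choose (c + i) (s - 1)) y := by
  classical
  have hcv := (choose_cvx (s-1)).shift c
  induction hd : S.card using Nat.strong_induction_on generalizing S with
  | _ d ih =>
  subst hd
  by_cases hC : Conn G S
  · rcases le_or_gt S.card y with h | h
    · exact (Nat.mul_le_mul_left _ (W_full hs S c)).trans (avg_mono _ hcv.1 h)
    · obtain ⟨a, ha, ha2, hW⟩ := hM S hN c y hC hP h
      refine (Nat.mul_le_mul_left _ hW).trans ?_
      have h1 := avg_mono _ hcv.1 (Nat.sub_le y a)
      have h2 := jensen hcv a y ha2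
      set f := fun i => Nat.choose (c + i) (s - 1)
      change y * (PS f (y - a) + (S.card - y + a) * f a) ≤ _
      have h3 : S.card = (y - a) + (S.card - y + a) := by omega
      calc _ = y * PS f (y - a) + (S.card - y + a) * (y * f a) := by ring
        _ ≤ (y - a) * PS f y + (S.card - y + a) * PS f y := by gcongr
        _ = ((y - a) + (S.card - y + a)) * PS f y := by ring
        _ = _ := by rw [← h3]
  · obtain ⟨A, B, rfl, hdis, hA, hB, hno⟩ := not_conn hC
    have h0 := card_union_of_disjoint hdis
    have hA' := card_pos.2 hA
    have hB' := card_pos.2 hB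
    have h1 := ih A.card (by omega) A (by omega) (hP.mono subset_union_left) rfl
    have h2 := ih B.card (by omega) B (by omega) (hP.mono subset_union_right) rfl
    refine (Nat.mul_le_mul_left _ (W_split hno)).trans ?_
    rw [h0, mul_add, add_mul]
    omega

theorem avg_max {s : ℕ} (hs : 1 ≤ s) {N : ℕ} (hM : ∀ S : Finset V, S.card < N → MainFor s G S)
    (c y : ℕ) (hy : 1 ≤ y) (S : Finset V) (hN : S.card < N) (hP : PB G S y) :
    W s (c + 1) G S ≤ S.card * Nat.choose (c + y) (s - 1) := by
  have h := avg hs hM (c + 1) y S hN hP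
  obtain ⟨y, rfl⟩ := Nat.exists_eq_add_of_le hy
  have h2 := PS_le (fun i => Nat.choose (c + 1 + i) (s - 1))
    ((choose_cvx (s-1)).shift (c+1)).1 y
  rw [← add_assoc c]
  rw [add_comm y 1] at h2
  have h3 := h.trans (Nat.mul_le_mul_left _ h2)
  have h4 : (1 + y) * W s (c + 1) G S ≤ (1 + y) * (S.card * Nat.choose (c + 1 + y) (s - 1)) := by
    linarith
  exact Nat.le_of_mul_le_mul_left h4 (by omega)

theorem main_lemma {s : ℕ} (hs : 1 ≤ s) (S : Finset V) : MainFor s G S := by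
  classical
  induction hd : S.card using Nat.strong_induction_on generalizing S G with
  | _ n ih =>
  intro c m hC0 hP0 hm
  subst hd
  obtain ⟨r, hr⟩ : S.Nonempty := card_pos.1 (by omega)
  obtain ⟨G', hC, hP, hWW, hdom⟩ := dominate (s := s) (c := c) hr hC0 hP0
  have hm1 : 1 ≤ m := by
    have := hP [r] (by simp) (by simp) (by simpa using hr)
    simpa using this
  set S' := S.erase r with hS'
  have hcS : S'.card + 1 = S.card := card_erase_add_one hr
  have hrS' : r ∉ S' := by simp [S']
  have hadj : ∀ b ∈ S', G'.Adj r b := fun b hb => hdom b (mem_of_mem_erase hb) (ne_of_mem_erase hb)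
  have hPS' : PB G' S' m := hP.mono (erase_subset _ _)
  have hM : ∀ T : Finset V, T.card < S.card → MainFor s G' T := fun T hT => ih T.card hT T rfl
  have hex : ∃ p, PB G' S' p := ⟨m, hPS'⟩
  set p := Nat.find hex with hp
  have hPp : PB G' S' p := Nat.find_spec hex
  obtain ⟨q, hq⟩ : S'.Nonempty := card_pos.1 (by omega)
  have hp1 : 1 ≤ p := by
    have := hPp [q] (by simp) (by simp) (by simpa using hq)
    simpa using this
  obtain ⟨Q, hQn, hQc, hQS, hQl⟩ : ∃ Q : List V, Q.Nodup ∧ Q.IsChain G'.Adj ∧ (∀ a ∈ Q, a ∈ S') ∧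
      Q.length = p := by
    have := Nat.find_min hex (m := p - 1) (by omega)
    unfold PB at this
    push Not at this
    obtain ⟨Q, h1, h2, h3, h4⟩ := this
    have := hPp Q h1 h2 h3
    exact ⟨Q, h1, h2, h3, by omega⟩
  have hQne : Q ≠ [] := by rintro rfl; simp at hQl; omega
  obtain ⟨B, hBS, hQB, hBC, hBno⟩ := comp_of_path hQc hQS hQne
  set R := S' \ B with hR
  have hcR : R.card + B.card = S'.card := card_sdiff_add_card_eq_card hBS
  have hQr : ∀ L : List V, L.Nodup → L.IsChain G'.Adj → (∀ a ∈ L, a ∈ S') → 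
      (∀ a ∈ L, a ∉ Q) → p + 1 + L.length ≤ m := by
    intro L h1 h2 h3 h4
    have := hP (Q ++ r :: L) ?_ ?_ ?_
    · simp at this; omega
    · rw [List.nodup_append]
      refine ⟨hQn, ?_, ?_⟩
      · simp only [List.nodup_cons]
        exact ⟨fun h => hrS' (h3 r h), h1⟩
      · intro a ha b hb
        rcases List.mem_cons.1 hb with rfl | hb
        · rintro rfl; exact hrS' (hQS a ha)
        · rintro rfl; exact h4 a hb ha
    · rw [List.isChain_append]
      refine ⟨hQc, ?_, ?_⟩
      · rw [List.isChain_cons]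
        refine ⟨fun b hb => hadj b (h3 b (List.mem_of_mem_head? hb)), h2⟩
      · intro a ha b hb
        simp at hb
        subst hb
        exact (hadj a (hQS a (List.mem_of_mem_getLast? ha))).symm
    · intro a ha
      simp only [List.mem_append, List.mem_cons] at ha
      rcases ha with ha | rfl | ha
      · exact mem_of_mem_erase (hQS a ha)
      · exact hr
      · exact mem_of_mem_erase (h3 a ha)
  have hpm : p + 1 ≤ m := by simpa using hQr [] (by simp) (by simp) (by simp) (by simp)
  obtain ⟨x, hx⟩ := Nat.exists_eq_add_of_le hpm
  have hPR : PB G' R x := by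
    intro L h1 h2 h3
    have := hQr L h1 h2 (fun a ha => (mem_sdiff.1 (h3 a ha)).1)
      (fun a ha haQ => (mem_sdiff.1 (h3 a ha)).2 (hQB a haQ))
    omega
  have hPB' : PB G' B p := hPp.mono hBS
  have hpB : p ≤ B.card := by
    have h := List.toFinset_card_of_nodup hQn
    rw [← hQl, ← h]
    exact card_le_card (fun a ha => hQB a (by simpa using ha))
  have hWS : W s c G S ≤ Nat.choose c (s - 1) + W s (c+1) G' S' := hWW.trans (W_remove hs hr)
  have hWBR : W s (c+1) G' S' ≤ W s (c+1) G' B + W s (c+1) G' R := by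
    have : S' = B ∪ R := by rw [hR, union_sdiff_of_subset hBS]
    rw [this]
    exact W_split (fun a ha b hb => hBno a ha b (mem_sdiff.1 hb).1 (mem_sdiff.1 hb).2)
  set f := fun i => Nat.choose (c + i) (s - 1) with hf
  set g := fun i => Nat.choose (c + 1 + i) (s - 1) with hg
  have hfm : Monotone f := ((choose_cvx (s-1)).shift c).1
  have hgm : Monotone g := ((choose_cvx (s-1)).shift (c+1)).1
  have hgf : ∀ i, g i = f (1 + i) := fun i => by simp [hf, hg, add_assoc]
  have red : ∀ a, 1 ≤ a → 2 * a + 1 ≤ m →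
      W s (c+1) G' S' ≤ PS g (m - a - 1) + (S.card - m + a) * f a →
      ∃ a, 1 ≤ a ∧ 2 * a + 1 ≤ m ∧ W s c G S ≤ PS f (m - a) + (S.card - m + a) * f a := by
    intro a h1 h2 h3
    refine ⟨a, h1, h2, ?_⟩
    have h4 := PS_shift f (m - a - 1)
    rw [show m - a - 1 + 1 = m - a by omega] at h4
    have h5 : (fun i => f (1 + i)) = g := funext (fun i => (hgf i).symm)
    rw [h5] at h4
    have h6 : f 0 = Nat.choose c (s - 1) := by simp [hf]
    omega
  change ∃ a, 1 ≤ a ∧ 2 * a + 1 ≤ m ∧ W s c G S ≤ PS f (m - a) + (S.card - m + a) * f a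
  rcases le_or_gt p x with hxp | hxp
  ·
    apply red p hp1 (by omega)
    have h1 := avg hs hM (c+1) p S' (by omega) hPp
    change _ ≤ _ * PS g p at h1
    have h2 : PS g p ≤ p * f p := by
      have := PS_le g hgm (p - 1)
      rw [show p - 1 + 1 = p by omega, hgf, show 1 + (p - 1) = p by omega] at this
      exact this
    have h3 := avg_mono g hgm hxp
    have h4 : S'.card = x + (S.card - m + p) := by omega
    have h5 : m - p - 1 = x := by omega
    rw [h5]
    have : p * W s (c+1) G' S' ≤ p * (PS g x + (S.card - m + p) * f p) := by
      calc _ ≤ (x + (S.card - m + p)) * PS g p := by rw [← h4]; exact h1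
        _ = x * PS g p + (S.card - m + p) * PS g p := by ring
        _ ≤ p * PS g x + (S.card - m + p) * (p * f p) := by gcongr
        _ = _ := by ring
    exact Nat.le_of_mul_le_mul_left this (by omega)
  have hWR : 1 ≤ x → W s (c+1) G' R ≤ R.card * f x := fun h => avg_max hs hM c x h R (by omega) hPR
  rcases hpB.eq_or_lt with hB | hB
  ·
    have hx1 : 1 ≤ x := by
      obtain ⟨z, hz⟩ : R.Nonempty := card_pos.1 (by omega)
      have := hPR [z] (by simp) (by simp) (by simpa using hz)
      simpa using this
    apply red x hx1 (by omega)
    have h1 : W s (c+1) G' B ≤ PS g p := by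
      have := W_full (G := G') hs B (c+1)
      rw [hB]
      exact this
    have h2 := hWR hx1
    rw [show m - x - 1 = p by omega, show S.card - m + x = R.card by omega]
    omega
  · have hx1 : 1 ≤ x := by
      obtain ⟨z, hz, hzQ⟩ : ∃ z ∈ B, z ∉ Q := by
        by_contra hcon
        push Not at hcon
        have : B ⊆ Q.toFinset := fun a ha => by simpa using hcon a ha
        have h1 := card_le_card this
        have h := List.toFinset_card_of_nodup hQn
        omega
      have := hQr [z] (by simp) (by simp) (by simpa using hBS hz) (by simpa using hzQ)
      simp at this
      omega
    have hWR := hWR hx1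
    obtain ⟨a', ha1, ha2, hWB⟩ := hM B (by omega) (c+1) p hBC hPB' hB
    change _ ≤ PS g (p - a') + (B.card - p + a') * g a' at hWB
    rw [hgf] at hWB
    rcases le_or_gt x (1 + a') with hxa | hxa
    · apply red (1 + a') (by omega) (by omega)
      have h1 : f x ≤ f (1 + a') := hfm hxa
      have h2 := le_PS_add g hgm (p - a') (x - 1) a' (by omega)
      rw [hgf] at h2
      rw [show m - (1 + a') - 1 = p - a' + (x - 1) by omega]
      have h3 : (B.card - p + a') + R.card = (x - 1) + (S.card - m + (1 + a')) := by omega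
      calc _ ≤ PS g (p - a') + (B.card - p + a') * f (1 + a') + R.card * f x := by omega
        _ ≤ PS g (p - a') + (B.card - p + a') * f (1 + a') + R.card * f (1 + a') := by gcongr
        _ = PS g (p - a') + ((B.card - p + a') + R.card) * f (1 + a') := by ring
        _ = PS g (p - a') + (x - 1) * f (1 + a') + (S.card - m + (1 + a')) * f (1 + a') := by
          rw [h3]; ring
        _ ≤ _ := by gcongr
    · apply red x hx1 (by omega)
      have h1 : f (1 + a') ≤ f x := hfm hxa.le
      have h2 := le_PS_add g hgm (p - a') a' a' (by omega)
      rw [hgf, show p - a' + a' = p by omega] at h2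
      rw [show m - x - 1 = p by omega]
      have h3 : (B.card - p) + R.card = S.card - m + x := by omega
      calc _ ≤ PS g (p - a') + (B.card - p + a') * f (1 + a') + R.card * f x := by omega
        _ = (PS g (p - a') + a' * f (1 + a')) + (B.card - p) * f (1 + a') + R.card * f x := by ring
        _ ≤ PS g p + (B.card - p) * f x + R.card * f x := by gcongr
        _ = PS g p + ((B.card - p) + R.card) * f x := by ring
        _ = _ := by rw [h3]

theorem EG {s : ℕ} (hs : 1 ≤ s) {m : ℕ} (hm : 1 ≤ m) (c : ℕ) (S : Finset V) (hP : PB G S m) :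
    W s c G S ≤ GB (fun i => Nat.choose (c + i) (s - 1)) m S.card := by
  classical
  have hcv := (choose_cvx (s-1)).shift c
  induction hd : S.card using Nat.strong_induction_on generalizing S with
  | _ d ih =>
  subst hd
  by_cases hC : Conn G S
  · rcases le_or_gt S.card m with h | h
    · rw [GB_small _ hm h]
      exact W_full hs S c
    · obtain ⟨a, ha, ha2, hW⟩ := main_lemma hs S c m hC hP h
      exact hW.trans (final_ineq hcv ha2 h.le)
  · obtain ⟨A, B, rfl, hdis, hA, hB, hno⟩ := not_conn hC
    have h0 := card_union_of_disjoint hdis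
    have hA' := card_pos.2 hA
    have hB' := card_pos.2 hB
    have h1 := ih A.card (by omega) A (hP.mono subset_union_left) rfl
    have h2 := ih B.card (by omega) B (hP.mono subset_union_right) rfl
    have h3 := GB_super hcv.1 hm A.card B.card
    have h4 := W_split (s := s) (c := c) hno
    rw [h0]
    omega

end Cliq

namespace Cliq
open Finset
variable {V : Type*} {G : SimpleGraph V} {x y : V}

/-- the invariant of the 2-connected reduction -/
structure Inv [DecidableEq V] (G : SimpleGraph V) (S : Finset V) (u v : V) (M : ℕ) : Prop where
  adj : G.Adj u v
  hu : u ∈ S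
  hv : v ∈ S
  conn : ∀ w ∈ S, Conn G (S.erase w)
  uv : UV G S u v M

theorem Inv.symm [DecidableEq V] {S : Finset V} {u v : V} {M : ℕ} (h : Inv G S u v M) :
    Inv G S v u M := ⟨h.adj.symm, h.hv, h.hu, h.conn, h.uv.symm⟩

open Classical in
/-- number of non-neighbours -/
noncomputable def nd (G : SimpleGraph V) (S : Finset V) (u : V) : ℕ :=
  (S.filter (fun b => b ≠ u ∧ ¬ G.Adj u b)).card

theorem nd_le {G' : SimpleGraph V} {S T : Finset V} {u : V} (hT : T ⊆ S)
    (h : ∀ b, G.Adj u b → G'.Adj u b) : nd G' T u ≤ nd G S u := by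
  classical
  refine card_le_card ?_
  intro z hz
  rw [mem_filter] at hz ⊢
  exact ⟨hT hz.1, hz.2.1, fun h' => hz.2.2 (h z h')⟩

theorem nd_lt {G' : SimpleGraph V} {S : Finset V} {u b : V}
    (h : ∀ b, G.Adj u b → G'.Adj u b) (hb : b ∈ S) (hbu : b ≠ u) (h1 : ¬ G.Adj u b)
    (h2 : G'.Adj u b) : nd G' S u < nd G S u := by
  classical
  refine card_lt_card ?_
  rw [ssubset_iff_of_subset]
  · refine ⟨b, mem_filter.2 ⟨hb, hbu, h1⟩, fun hz => (mem_filter.1 hz).2.2 h2⟩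
  · intro z hz
    rw [mem_filter] at hz ⊢
    exact ⟨hz.1, hz.2.1, fun h' => hz.2.2 (h z h')⟩

theorem conn_path {S : Finset V} (hC : Conn G S) {a b : V} (ha : a ∈ S) (hb : b ∈ S) :
    ∃ P : List V, P.Nodup ∧ P.IsChain G.Adj ∧ (∀ z ∈ P, z ∈ S) ∧ P.head? = some a ∧
      P.getLast? = some b := by
  classical
  set A := S.filter (fun b => ∃ P : List V, P.Nodup ∧ P.IsChain G.Adj ∧ (∀ z ∈ P, z ∈ S) ∧
    P.head? = some a ∧ P.getLast? = some b) with hA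
  by_cases h : A = S
  · rw [← h] at hb
    exact (mem_filter.1 hb).2
  · exfalso
    obtain ⟨c, hc, d, hd, hdA, hadj⟩ := hC A (filter_subset _ _)
      ⟨a, mem_filter.2 ⟨ha, [a], by simp, by simp, by simpa using ha, by simp, by simp⟩⟩ h
    obtain ⟨hcS, P, h1, h2, h3, h4, h5⟩ := mem_filter.1 hc
    apply hdA
    refine mem_filter.2 ⟨hd, ?_⟩
    by_cases hdP : d ∈ P
    · obtain ⟨P1, P2, rfl⟩ := List.append_of_mem hdP
      rw [List.append_cons] at h1 h2 h3
      refine ⟨P1 ++ [d], (List.nodup_append.1 h1).1, (List.isChain_append.1 h2).1,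
        fun z hz => h3 z (List.mem_append_left _ hz), ?_, by simp⟩
      cases P1 <;> simpa using h4
    · refine ⟨P ++ [d], ?_, ?_, ?_, ?_, by simp⟩
      · rw [List.nodup_append]
        refine ⟨h1, by simp, ?_⟩
        intro e he f hf
        simp at hf
        subst hf
        rintro rfl; exact hdP he
      · rw [List.isChain_append]
        refine ⟨h2, by simp, ?_⟩
        intro e he f hf
        rw [h5] at he
        simp at he hf
        subst he hf
        exact hadj
      · intro z hz
        simp at hz
        rcases hz with hz | rfl
        · exact h3 z hz
        · exact hd
      · rw [List.head?_append, h4]; simp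

theorem nil_or_append {V : Type*} (l : List V) : l = [] ∨ ∃ T b, l = T ++ [b] := by
  rcases List.eq_nil_or_concat l with h | ⟨T, b, h⟩
  · exact .inl h
  · exact .inr ⟨T, b, by simp [h]⟩

/-- move the component Y of G - {u,x} from x to v -/
def mv (G : SimpleGraph V) (Y : Finset V) (x v : V) (hv : v ∉ Y) : SimpleGraph V where
  Adj a b := (G.Adj a b ∧ ¬ (a = x ∧ b ∈ Y) ∧ ¬ (b = x ∧ a ∈ Y)) ∨
    (a = v ∧ b ∈ Y ∧ G.Adj x b) ∨ (b = v ∧ a ∈ Y ∧ G.Adj x a)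
  symm := ⟨by
    intro a b h
    have := G.adj_comm a b
    tauto⟩
  loopless := ⟨by
    intro a h
    rcases h with h | ⟨rfl, h, -⟩ | ⟨rfl, h, -⟩
    · exact G.irrefl h.1
    · exact hv h
    · exact hv h⟩

theorem step_mv [DecidableEq V] {S : Finset V} {u v x : V} {M s c : ℕ} (hI : Inv G S u v M)
    (hxS : x ∈ S) (hux : G.Adj u x) (hxv : x ≠ v)
    (hnc : ¬ Conn G ((S.erase u).erase x)) :
    ∃ G' : SimpleGraph V, Inv G' S u v M ∧ W s c G S ≤ W s c G' S ∧
      nd G' S u + nd G' S v < nd G S u + nd G S v := by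
  obtain ⟨adj, hu, hv, conn, uv⟩ := hI
  have huv := adj.ne
  have hxu := hux.ne'
  obtain ⟨Y, Z, hS, hdis, hYne, hvZ, hno⟩ : ∃ Y Z : Finset V, (S.erase u).erase x = Y ∪ Z ∧
      Disjoint Y Z ∧ Y.Nonempty ∧ v ∈ Z ∧ ∀ a ∈ Y, ∀ b ∈ Z, ¬ G.Adj a b := by
    obtain ⟨A, B, h1, h2, h3, h4, h5⟩ := not_conn hnc
    have hv' : v ∈ A ∪ B := by rw [← h1]; simp [hv, hxv.symm, huv.symm]
    rcases mem_union.1 hv' with h | h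
    · exact ⟨B, A, by rw [h1, union_comm], h2.symm, h4, h, fun a ha b hb hab => h5 b hb a ha hab.symm⟩
    · exact ⟨A, B, h1, h2, h3, h, h5⟩
  have hmem : ∀ a, a ∈ S → a = u ∨ a = x ∨ a ∈ Y ∨ a ∈ Z := by
    intro a ha
    by_cases h1 : a = u
    · exact .inl h1
    · by_cases h2 : a = x
      · exact .inr (.inl h2)
      · have : a ∈ Y ∪ Z := by rw [← hS]; simp [h1, h2, ha]
        rcases mem_union.1 this with h | h
        · exact .inr (.inr (.inl h))
        · exact .inr (.inr (.inr h))
  have hYS : ∀ a ∈ Y, a ∈ S ∧ a ≠ u ∧ a ≠ x := by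
    intro a ha
    have : a ∈ (S.erase u).erase x := by rw [hS]; exact mem_union_left _ ha
    simp at this; tauto
  have hZS : ∀ a ∈ Z, a ∈ S ∧ a ≠ u ∧ a ≠ x := by
    intro a ha
    have : a ∈ (S.erase u).erase x := by rw [hS]; exact mem_union_right _ ha
    simp at this; tauto
  have hYZ : ∀ a ∈ Y, a ∉ Z := fun a h1 h2 => (disjoint_left.1 hdis) h1 h2
  have hvY : v ∉ Y := fun h => hYZ v h hvZ
  have hxY : x ∉ Y := fun h => (hYS x h).2.2 rfl
  have huY : u ∉ Y := fun h => (hYS u h).2.1 rfl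
  set G' := mv G Y x v hvY with hG'
  have k1 : ∀ a b, a ≠ x → b ≠ x → G.Adj a b → G'.Adj a b := by
    intro a b ha hb h
    exact .inl ⟨h, by tauto, by tauto⟩
  have k2 : ∀ a b, a ∉ Y → b ∉ Y → (G'.Adj a b ↔ G.Adj a b) := by
    intro a b ha hb
    simp only [hG', mv]
    tauto
  have k3 : ∀ a, a ∈ Y → G.Adj x a → G'.Adj a v := fun a ha h => .inr (.inr ⟨rfl, ha, h⟩)
  have k4 : ∀ a b, a ∈ Y → b ∈ S → G'.Adj a b → (b ∈ Y ∧ G.Adj a b) ∨ (b = u ∧ G.Adj a b) ∨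
      (b = v ∧ G.Adj x a) := by
    intro a b ha hb h
    have ha2 := hYS a ha
    rcases h with ⟨h1, h2, h3⟩ | ⟨rfl, h, -⟩ | ⟨rfl, -, h2⟩
    · rcases hmem b hb with h | h | h | h
      · exact .inr (.inl ⟨h, h1⟩)
      · exact absurd ⟨h, ha⟩ h3
      · exact .inl ⟨h, h1⟩
      · exact absurd h1 (hno a ha b h)
    · exact absurd ha hvY
    · exact .inr (.inr ⟨rfl, h2⟩)
  have hZx : Conn G (insert x Z) := by
    refine conn_anchor x (mem_insert_self _ _) ?_
    intro B hB hne hxB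
    have hBZ : ∀ a ∈ B, a ∈ Z := by
      intro a ha
      rcases mem_insert.1 (hB ha) with rfl | h
      · exact absurd ha hxB
      · exact h
    obtain ⟨a, ha, b, hb, hbB, hab⟩ := conn u hu B
      (fun a ha => by have := hZS a (hBZ a ha); simp [this.1, this.2.1]) hne
      (by rintro rfl; exact hxB (by simp [hxS, hxu]))
    refine ⟨a, ha, b, ?_, hbB, hab⟩
    simp at hb
    rcases hmem b hb.2 with h | h | h | h
    · exact absurd h hb.1
    · simp [h]
    · exact absurd hab.symm (hno b h a (hBZ a ha))
    · simp [h]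
  obtain ⟨y0, hy0, hxy0⟩ : ∃ y ∈ Y, G.Adj x y := by
    obtain ⟨a, ha, b, hb, hbB, hab⟩ := conn u hu Y
      (fun a ha => by have := hYS a ha; simp [this.1, this.2.1]) hYne
      (by intro h; exact hvY (by rw [h]; simp [hv, huv.symm]))
    simp at hb
    rcases hmem b hb.2 with h | h | h | h
    · exact absurd h hb.1
    · subst h; exact ⟨a, ha, hab.symm⟩
    · exact absurd h hbB
    · exact absurd hab (hno a ha b h)
  refine ⟨G', ⟨k1 u v hxu.symm hxv.symm adj, hu, hv, ?_, ?_⟩, ?_, ?_⟩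
  ·
    intro w hw
    by_cases hwu : w = u
    · subst hwu
      refine conn_anchor v (by simp [hv, huv.symm]) ?_
      intro B hB hne hvB
      by_cases hBY : (B ∩ Y).Nonempty
      · obtain ⟨a, ha, b, hb, hbB, hab⟩ := conn w hw (B ∩ Y) (inter_subset_left.trans hB) hBY
          (by intro h; have : v ∈ B ∩ Y := by rw [h]; simp [hv, huv.symm]
              exact hvY (mem_inter.1 this).2)
        obtain ⟨haB, haY⟩ := mem_inter.1 ha
        have haS := hYS a haY
        have hb' := mem_erase.1 hb
        rcases hmem b hb'.2 with h | h | h | h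
        · exact absurd h hb'.1
        · subst h
          exact ⟨a, haB, v, by simp [hv, huv.symm], hvB, k3 a haY hab.symm⟩
        · exact ⟨a, haB, b, hb, fun h' => hbB (mem_inter.2 ⟨h', h⟩), k1 a b haS.2.2 (hYS b h).2.2 hab⟩
        · exact absurd hab (hno a haY b h)
      · have hnY : ∀ a ∈ B, a ∉ Y := fun a h1 h2 => hBY ⟨a, mem_inter.2 ⟨h1, h2⟩⟩
        obtain ⟨a, ha, b, hb, hbB, hab⟩ := hZx B (by
          intro a ha
          have := mem_erase.1 (hB ha)
          have h2 := hnY a ha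
          have h3 := hmem a this.2
          simp; tauto) hne (by rintro rfl; exact hvB (by simp [hvZ]))
        have hbY : b ∉ Y := by
          rcases mem_insert.1 hb with rfl | h
          · exact hxY
          · exact fun h' => hYZ b h' h
        refine ⟨a, ha, b, ?_, hbB, (k2 a b (hnY a ha) hbY).2 hab⟩
        rcases mem_insert.1 hb with rfl | h
        · simp [hxS, hxu]
        · simp [hZS b h]
    · have huw : u ∈ S.erase w := by simp [hu, Ne.symm hwu]
      refine conn_anchor u huw ?_
      intro B hB hne huB
      by_cases hxB : x ∈ B
      · exact ⟨x, hxB, u, huw, huB, (k2 x u hxY huY).2 hux.symm⟩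
      by_cases hvB : v ∈ B
      · exact ⟨v, hvB, u, huw, huB, (k2 v u hvY huY).2 adj.symm⟩
      by_cases hBY : (B ∩ Y).Nonempty
      · have hBw : ∀ a ∈ B, a ≠ w ∧ a ∈ S := fun a ha => by have := hB ha; simpa using this
        by_cases hwv : w = v
        · subst hwv
          obtain ⟨a, ha, b, hb, hbB, hab⟩ := conn x hxS (B ∩ Y) (by
              intro a ha
              have := hYS a (mem_inter.1 ha).2
              simp [this.1, this.2.2]) hBY
            (by intro h; have : u ∈ B ∩ Y := by rw [h]; simp [hu, hxu.symm]
                exact huY (mem_inter.1 this).2)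
          obtain ⟨haB, haY⟩ := mem_inter.1 ha
          have haS := hYS a haY
          have hb' := mem_erase.1 hb
          have hadj := k1 a b haS.2.2 hb'.1 hab
          rcases hmem b hb'.2 with h | h | h | h
          · subst h; exact ⟨a, haB, b, huw, huB, hadj⟩
          · exact absurd h hb'.1
          · refine ⟨a, haB, b, ?_, fun h' => hbB (mem_inter.2 ⟨h', h⟩), hadj⟩
            refine mem_erase.2 ⟨?_, hb'.2⟩
            rintro rfl; exact hvY h
          · exact absurd hab (hno a haY b h)
        · obtain ⟨a, ha, b, hb, hbB, hab⟩ := conn w hw (B ∩ Y) (inter_subset_left.trans hB) hBY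
            (by intro h; have : u ∈ B ∩ Y := by rw [h]; exact huw
                exact huY (mem_inter.1 this).2)
          obtain ⟨haB, haY⟩ := mem_inter.1 ha
          have haS := hYS a haY
          have hb' := mem_erase.1 hb
          rcases hmem b hb'.2 with h | h | h | h
          · subst h; exact ⟨a, haB, b, huw, huB, k1 a b haS.2.2 hxu.symm hab⟩
          · subst h
            exact ⟨a, haB, v, by simp [hv, Ne.symm hwv], hvB, k3 a haY hab.symm⟩
          · exact ⟨a, haB, b, hb, fun h' => hbB (mem_inter.2 ⟨h', h⟩),
              k1 a b haS.2.2 (hYS b h).2.2 hab⟩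
          · exact absurd hab (hno a haY b h)
      · have hnY : ∀ a ∈ B, a ∉ Y := fun a h1 h2 => hBY ⟨a, mem_inter.2 ⟨h1, h2⟩⟩
        obtain ⟨a, ha, b, hb, hbB, hab⟩ := conn w hw B hB hne (by rintro rfl; exact huB huw)
        have haZ : a ∈ Z := by
          rcases hmem a (mem_erase.1 (hB ha)).2 with h | h | h | h
          · exact absurd (h ▸ ha) huB
          · exact absurd (h ▸ ha) hxB
          · exact absurd h (hnY a ha)
          · exact h
        have hbY : b ∉ Y := fun h => hno b h a haZ hab.symm
        exact ⟨a, ha, b, hb, hbB, (k2 a b (hnY a ha) hbY).2 hab⟩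
  ·
    intro l h1 h2 h3 h4 h5
    obtain ⟨T, rfl⟩ : ∃ T, l = u :: (T ++ [v]) := by
      cases l with
      | nil => simp at h4
      | cons a l =>
        simp at h4
        subst h4
        rcases nil_or_append l with rfl | ⟨T, b, rfl⟩
        · simp at h5; exact absurd h5 huv
        · refine ⟨T, ?_⟩
          rw [← List.cons_append, List.getLast?_append] at h5
          simp at h5
          rw [h5]
    have hTS : ∀ a ∈ T, a ∈ S := fun a ha => h3 a (by simp [ha])
    have hTn : T.Nodup := by
      rw [List.nodup_cons, List.nodup_append] at h1; exact h1.2.1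
    have huT : u ∉ T := by
      rw [List.nodup_cons] at h1; intro h; exact h1.1 (by simp [h])
    have hvT : v ∉ T := by
      rw [List.nodup_cons, List.nodup_append] at h1
      intro h; exact h1.2.2.2 v h v (by simp) rfl
    have hTc : T.IsChain G'.Adj := by
      rw [List.isChain_cons, List.isChain_append] at h2
      exact h2.2.1
    have hside := chain_side (G := G') (A := Y) (B := (S.erase u).erase v) (by
      intro a ha b hb hbY hab
      simp at hb
      have := k4 a b ha hb.2.2 hab
      tauto) (by
        intro a ha
        have := hYS a ha
        simp only [mem_erase]
        exact ⟨fun e => hvY (e ▸ ha), this.2.1, this.1⟩) T hTc (by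
        intro a ha
        simp only [mem_erase]
        exact ⟨fun e => hvT (e ▸ ha), fun e => huT (e ▸ ha), hTS a ha⟩)
    have hout : (∀ a ∈ T, a ∉ Y) → (u :: (T ++ [v])).length ≤ M := by
      intro hT
      refine uv _ h1 ?_ h3 h4 h5
      refine List.IsChain.imp_of_mem_imp ?_ h2
      have : ∀ a ∈ u :: (T ++ [v]), a ∉ Y := by
        intro a ha
        simp at ha
        rcases ha with rfl | ha | rfl
        · exact huY
        · exact hT a ha
        · exact hvY
      intro a b ha hb hab
      exact (k2 a b (this a ha) (this b hb)).1 hab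
    rcases hside with hT | hT
    · rcases nil_or_append T with rfl | ⟨T', z, hTdef⟩
      · exact hout (by simp)
      · obtain ⟨P, p1, p2, p3, p4, p5⟩ := conn_path hZx (mem_insert_self x Z)
          (mem_insert_of_mem hvZ)
        have hPY : ∀ a ∈ P, a ∉ Y ∧ a ≠ u ∧ a ∈ S := by
          intro a ha
          rcases mem_insert.1 (p3 a ha) with rfl | h
          · exact ⟨hxY, hxu, hxS⟩
          · exact ⟨fun h' => hYZ a h' h, (hZS a h).2.1, (hZS a h).1⟩
        have hzx : G.Adj z x := by
          rw [List.isChain_cons, List.isChain_append] at h2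
          have hzv := h2.2.2.2 z (by simp [hTdef]) v (by simp)
          rcases k4 z v (hT z (by simp [hTdef])) hv hzv with h | h | h
          · exact absurd h.1 hvY
          · exact absurd h.1 huv.symm
          · exact h.2.symm
        have hPne : 2 ≤ P.length := by
          rcases P with _ | ⟨a, _ | ⟨b, P⟩⟩
          · simp at p4
          · simp at p4 p5; exact absurd (p4.symm.trans p5) hxv
          · simp
        have hmain := uv ((u :: T) ++ P) ?_ ?_ ?_ ?_ ?_
        · simp at hmain ⊢; omega
        · rw [List.nodup_append]
          refine ⟨List.nodup_cons.2 ⟨huT, hTn⟩, p1, ?_⟩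
          intro a ha b hb
          rintro rfl
          rcases List.mem_cons.1 ha with rfl | ha
          · exact (hPY a hb).2.1 rfl
          · exact (hPY a hb).1 (hT a ha)
        · rw [List.isChain_append]
          refine ⟨?_, p2, ?_⟩
          · have h6 : (u :: T).IsChain G'.Adj := by
              rw [← List.cons_append, List.isChain_append] at h2
              exact h2.1
            have h7 : ∀ a ∈ u :: T, a = u ∨ a ∈ Y := by
              intro a ha
              rcases List.mem_cons.1 ha with rfl | ha
              · exact .inl rfl
              · exact .inr (hT a ha)
            refine List.IsChain.imp_of_mem_imp ?_ h6
            intro a b ha hb hab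
            rcases h7 a ha with rfl | ha
            · rcases h7 b hb with rfl | hb
              · exact absurd hab (G'.irrefl)
              · rcases k4 b a hb hu hab.symm with h | h | h
                · exact absurd h.1 huY
                · exact h.2.symm
                · exact absurd h.1 huv
            · have hbS : b ∈ S ∧ b ≠ v := by
                rcases h7 b hb with rfl | hb
                · exact ⟨hu, huv⟩
                · exact ⟨(hYS b hb).1, fun e => hvY (e ▸ hb)⟩
              rcases k4 a b ha hbS.1 hab with h | h | h
              · exact h.2
              · exact h.2
              · exact absurd h.1 hbS.2
          · intro a ha b hb
            rw [p4] at hb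
            rw [hTdef, ← List.cons_append, List.getLast?_append] at ha
            simp at ha hb
            subst ha hb
            exact hzx
        · intro a ha
          rcases List.mem_append.1 ha with ha | ha
          · rcases List.mem_cons.1 ha with rfl | ha
            · exact hu
            · exact hTS a ha
          · exact (hPY a ha).2.2
        · simp
        · rw [List.getLast?_append, p5]; simp
    · exact hout hT
  ·
    have bad : ∀ K : Finset V, K ⊆ S → G.IsClique (K : Set V) → (x ∈ K ∧ ∃ y ∈ K, y ∈ Y) →
        ∀ a ∈ K, a = x ∨ a = u ∨ a ∈ Y := by
      intro K hKS hK ⟨hx, y, hyK, hyY⟩ a ha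
      rcases hmem a (hKS ha) with h | h | h | h
      · exact .inr (.inl h)
      · exact .inl h
      · exact .inr (.inr h)
      · have : y ≠ a := fun e => hYZ y hyY (e ▸ h)
        exact absurd (hK hyK ha this) (hno y hyY a h)
    have badv : ∀ K : Finset V, K ⊆ S → G.IsClique (K : Set V) → (x ∈ K ∧ ∃ y ∈ K, y ∈ Y) →
        v ∉ K := by
      intro K h1 h2 h3 h4
      rcases bad K h1 h2 h3 v h4 with h | h | h
      · exact hxv h.symm
      · exact huv h.symm
      · exact hvY h
    classical
    refine W_transfer (fun K => if (x ∈ K ∧ ∃ y ∈ K, y ∈ Y) then insert v (K.erase x) else K) ?_ ?_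
    · intro K hKS hK
      split_ifs with h
      · have hb := bad K hKS hK h
        have hbv := badv K hKS hK h
        have hva : ∀ a ∈ K, a ≠ x → G'.Adj v a := by
          intro a ha hax
          rcases hb a ha with h' | h' | h'
          · exact absurd h' hax
          · subst h'; exact (k2 v a hvY huY).2 adj.symm
          · exact (k3 a h' (hK h.1 ha (Ne.symm hax))).symm
        refine ⟨?_, ?_, ?_⟩
        · intro a ha
          rcases mem_insert.1 ha with rfl | ha
          · exact hv
          · exact hKS (mem_of_mem_erase ha)
        · intro a ha b hb hab
          simp at ha hb
          rcases ha with rfl | ha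
          · rcases hb with rfl | hb
            · exact absurd rfl hab
            · exact hva b hb.1 hb.2
          · rcases hb with rfl | hb
            · exact (hva a ha.1 ha.2).symm
            · exact k1 a b ha.2 hb.2 (hK ha.1 hb.1 hab)
        · rw [card_insert_of_notMem (by simp [hbv]), card_erase_of_mem h.1]
          have := card_pos.2 ⟨x, h.1⟩
          omega
      · refine ⟨hKS, ?_, rfl⟩
        intro a ha b hb hab
        refine .inl ⟨hK ha hb hab, ?_, ?_⟩
        · rintro ⟨rfl, h'⟩; exact h ⟨ha, b, hb, h'⟩
        · rintro ⟨rfl, h'⟩; exact h ⟨hb, a, ha, h'⟩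
    · have mix : ∀ K L : Finset V, G.IsClique (K : Set V) → 
          (x ∈ L ∧ ∃ y ∈ L, y ∈ Y) → K ≠ insert v (L.erase x) := by
        rintro K L hK ⟨hx, y, hyL, hyY⟩ rfl
        have : y ≠ v := fun e => hvY (e ▸ hyY)
        exact hno y hyY v hvZ (hK (by simp [hyL, (hYS y hyY).2.2] : y ∈ _) (by simp : v ∈ _) this)
      intro K hKS hK L hLS hL
      beta_reduce
      split_ifs with h1 h2 h2
      · intro h
        have hyK := badv K hKS hK h1
        have hyL := badv L hLS hL h2
        ext a
        have := congrArg (fun s => a ∈ s) h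
        simp at this
        by_cases hay : a = v
        · subst hay; simp [hyK, hyL]
        · by_cases hax : a = x
          · subst hax; simp [h1.1, h2.1]
          · simpa [hay, hax] using this
      · intro h; exact absurd h.symm (mix L K hL h1)
      · intro h; exact absurd h (mix K L hK h2)
      · exact id
  · have a1 : nd G' S u ≤ nd G S u := nd_le (Subset.refl _) (fun b h =>
      .inl ⟨h, fun h' => hxu h'.1.symm, fun h' => huY h'.2⟩)
    have a2 : nd G' S v < nd G S v := nd_lt (b := y0) (fun b h =>
      .inl ⟨h, fun h' => hxv h'.1.symm, fun h' => hvY h'.2⟩) (hYS y0 hy0).1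
      (fun e => hvY (e ▸ hy0)) (fun h => hno y0 hy0 v hvZ h.symm) (k3 y0 hy0 hxy0).symm
    omega

end Cliq

namespace Cliq
open Finset
variable {V : Type*} {G : SimpleGraph V} {x y : V}

theorem step [DecidableEq V] {S : Finset V} {u v : V} {M s : ℕ} (hs : 2 ≤ s) (hI : Inv G S u v M)
    (hnd : ∃ z ∈ S, z ≠ u ∧ ¬ G.Adj u z) :
    (∃ G' : SimpleGraph V, Inv G' S u v M ∧ W s 0 G S ≤ W s 0 G' S ∧
      nd G' S u + nd G' S v < nd G S u + nd G S v) ∨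
    (∃ (G' : SimpleGraph V) (x : V), x ∈ S ∧ x ≠ u ∧ x ≠ v ∧ Inv G' (S.erase x) u v M ∧
      W s 0 G S ≤ W s 0 G' (S.erase x) + Nat.choose 0 (s - 2) ∧
      nd G' (S.erase x) u + nd G' (S.erase x) v ≤ nd G S u + nd G S v) := by
  classical
  have huv := hI.adj.ne
  obtain ⟨z, hz, hzu, hzn⟩ := hnd
  have hzv : z ≠ v := by rintro rfl; exact hzn hI.adj
  obtain ⟨x, hx, b, hb, hbA, hxb⟩ := hI.conn v hI.hv
    ((S.erase v).filter (fun b => b = u ∨ G.Adj u b)) (filter_subset _ _)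
    ⟨u, by simp [hI.hu, huv]⟩ (by
      intro h
      have : z ∈ S.erase v := by simp [hz, hzv]
      rw [← h] at this
      have := (mem_filter.1 this).2
      tauto)
  obtain ⟨hx1, hx2⟩ := mem_filter.1 hx
  obtain ⟨hxv, hxS⟩ := mem_erase.1 hx1
  have hbA : ¬ (b = u ∨ G.Adj u b) := fun h => hbA (mem_filter.2 ⟨hb, h⟩)
  push Not at hbA
  obtain ⟨hbv, hbS⟩ := mem_erase.1 hb
  have hxu : x ≠ u := by rintro rfl; exact hbA.2 hxb
  have hux : G.Adj u x := by tauto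
  have hadj : G.Adj x u := hux.symm
  by_cases hnc : Conn G ((S.erase u).erase x)
  swap
  · exact .inl (step_mv hI hxS hux hxv hnc)
  have a0 : (shift G x u).Adj u v := (shift_y hadj v).2 ⟨huv.symm, .inl hI.adj⟩
  have aUV := shift_UV hadj hxS hI.hu hxv.symm huv.symm hI.uv
  have aW : W s 0 G S ≤ W s 0 (shift G x u) S := W_shift hadj hI.hu
  have mu : ∀ c, G.Adj u c → (shift G x u).Adj u c := fun c h =>
    (shift_y hadj c).2 ⟨h.ne', .inl h⟩
  have mv : ∀ c, G.Adj v c → (shift G x u).Adj v c := by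
    intro c h
    by_cases hc : c = x
    · subst hc
      exact ((shift_x hadj v).2 ⟨h.symm, .inr hI.adj⟩).symm
    · exact shift_notx hadj hxv.symm hc h
  by_cases hcom : ∃ z ∈ S, G.Adj x z ∧ G.Adj u z
  · left
    obtain ⟨z, hzS, hxz, huz⟩ := hcom
    refine ⟨shift G x u, ⟨a0, hI.hu, hI.hv, ?_, aUV⟩, aW, ?_⟩
    · intro w hw
      by_cases hwu : w = u
      · subst hwu
        refine conn_anchor x (by simp [hxS, hxu]) ?_
        intro B hB hne hxB
        by_cases hBe : B = (S.erase w).erase x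
        · refine ⟨z, ?_, x, by simp [hxS, hxu], hxB, ((shift_x hadj z).2 ⟨hxz, .inr huz⟩).symm⟩
          rw [hBe]
          simp [hzS, hxz.ne', huz.ne']
        · have hB' : B ⊆ (S.erase w).erase x := by
            intro a ha
            exact mem_erase.2 ⟨fun e => hxB (e ▸ ha), hB ha⟩
          obtain ⟨a, ha, c, hc, hcB, hac⟩ := hnc B hB' hne hBe
          have ha' := hB' ha
          refine ⟨a, ha, c, mem_of_mem_erase hc, hcB, ?_⟩
          exact shift_notx hadj (ne_of_mem_erase ha') (ne_of_mem_erase hc) hac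
      · by_cases hwx : w = x
        · subst hwx
          refine conn_anchor u (by simp [hI.hu, hxu.symm]) ?_
          intro B hB hne huB
          obtain ⟨a, ha, c, hc, hcB, hac⟩ := hI.conn w hw B hB hne
            (by rintro rfl; exact huB (by simp [hI.hu, hxu.symm]))
          exact ⟨a, ha, c, hc, hcB,
            shift_notx hadj (ne_of_mem_erase (hB ha)) (ne_of_mem_erase hc) hac⟩
        · exact conn_shift hadj (by simp [hxS, Ne.symm hwx]) (by simp [hI.hu, Ne.symm hwu])
            (hI.conn w hw)
    · have h1 := nd_le (Subset.refl S) mv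
      have h2 := nd_lt mu hbS hbA.1 hbA.2 ((shift_y hadj b).2 ⟨hbA.1, .inr hxb⟩)
      omega
  · right
    push Not at hcom
    refine ⟨shift G x u, x, hxS, hxu, hxv, ⟨a0, by simp [hI.hu, hxu.symm], by simp [hI.hv, hxv.symm],
      ?_, fun l h1 h2 h3 => aUV l h1 h2 (fun a ha => mem_of_mem_erase (h3 a ha))⟩, ?_, ?_⟩
    · intro w hw
      obtain ⟨hwx, hwS⟩ := mem_erase.1 hw
      by_cases hwu : w = u
      · subst hwu
        rw [erase_right_comm]
        intro B hB hne hneq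
        obtain ⟨a, ha, c, hc, hcB, hac⟩ := hnc B hB hne hneq
        exact ⟨a, ha, c, hc, hcB,
          shift_notx hadj (ne_of_mem_erase (hB ha)) (ne_of_mem_erase hc) hac⟩
      · have huw : u ∈ (S.erase x).erase w := by simp [hI.hu, hxu.symm, Ne.symm hwu]
        refine conn_anchor u huw ?_
        intro B hB hne huB
        have hB' : B ⊆ S.erase w := by
          intro a ha
          have := hB ha
          simp only [mem_erase] at this ⊢
          tauto
        obtain ⟨a, ha, c, hc, hcB, hac⟩ := hI.conn w hwS B hB' hne (by
          rintro rfl; exact huB (by simp [hI.hu, Ne.symm hwu]))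
        have hax : a ≠ x := (mem_erase.1 (mem_erase.1 (hB ha)).2).1
        by_cases hcx : c = x
        · subst hcx
          exact ⟨a, ha, u, huw, huB,
            ((shift_y hadj a).2 ⟨fun e => huB (e ▸ ha), .inr hac.symm⟩).symm⟩
        · refine ⟨a, ha, c, ?_, hcB, shift_notx hadj hax hcx hac⟩
          simp only [mem_erase] at hc ⊢
          tauto
    · refine aW.trans (W_pendant (u := u) hs hxS ?_)
      intro c hc h
      obtain ⟨h1, h2⟩ := (shift_x hadj c).1 h
      rcases h2 with h2 | h2
      · exact h2
      · exact absurd h2 (hcom c hc h1)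
    · have h1 := nd_le (erase_subset x S) mv
      have h2 := nd_le (erase_subset x S) mu
      omega

theorem claim [DecidableEq V] {s m : ℕ} (hs : 2 ≤ s) (hm : 1 ≤ m) {S : Finset V} {u v : V}
    (hI : Inv G S u v (m + 2)) :
    W s 0 G S ≤ PS (fun i => Nat.choose i (s - 1)) 2 +
      GB (fun i => Nat.choose (2 + i) (s - 1)) m (S.card - 2) := by
  classical
  induction hd : S.card + (nd G S u + nd G S v) using Nat.strong_induction_on generalizing G S u v with
  | _ d ih =>
  have gen : ∀ u v, S.card + (nd G S u + nd G S v) = d → Inv G S u v (m + 2) →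
      (∃ z ∈ S, z ≠ u ∧ ¬ G.Adj u z) →
      W s 0 G S ≤ PS (fun i => Nat.choose i (s - 1)) 2 +
      GB (fun i => Nat.choose (2 + i) (s - 1)) m (S.card - 2) := by
    intro u v hd hI hz
    rcases step hs hI hz with ⟨G', h1, h2, h3⟩ | ⟨G', x, h1, h2, h3, h4, h5, h6⟩
    · exact h2.trans (ih _ (by omega) h1 rfl)
    · have hc := card_erase_add_one h1
      have h7 := ih _ (by omega) h4 rfl
      have h8 : 2 ≤ (S.erase x).card := by
        have : ({u, v} : Finset V) ⊆ S.erase x := by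
          intro a ha
          simp only [mem_insert, mem_singleton] at ha
          rcases ha with rfl | rfl
          · exact h4.hu
          · exact h4.hv
        have h9 := card_le_card this
        rw [card_pair h4.adj.ne] at h9
        exact h9
      have h9 := GB_step ((choose_cvx (s-1)).shift 2).1 hm ((S.erase x).card - 2)
      rw [show (S.erase x).card - 2 + 1 = S.card - 2 by omega] at h9
      have h10 : Nat.choose 0 (s - 2) ≤ Nat.choose (2 + 0) (s - 1) := by
        rcases Nat.eq_or_lt_of_le hs with h | h
        · subst h; simp
        · rw [Nat.choose_eq_zero_of_lt (by omega : 0 < s - 2)]; omega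
      omega
  by_cases hu : ∃ z ∈ S, z ≠ u ∧ ¬ G.Adj u z
  · exact gen u v hd hI hu
  by_cases hv : ∃ z ∈ S, z ≠ v ∧ ¬ G.Adj v z
  · exact gen v u (by omega) hI.symm hv
  push Not at hu hv
  have huv := hI.adj.ne
  have hvu : v ∈ S.erase u := by simp [hI.hv, huv.symm]
  set F := (S.erase u).erase v with hF
  have hFm : ∀ a ∈ F, a ∈ S ∧ a ≠ u ∧ a ≠ v := by
    intro a ha
    simp [hF] at ha; tauto
  have hPB : PB G F m := by
    intro Q h1 h2 h3
    rcases nil_or_append Q with hQ | ⟨T, z, hQ⟩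
    · simp [hQ]
    · have := hI.uv (u :: (Q ++ [v])) ?_ ?_ ?_ (by simp) ?_
      · simp at this; omega
      · rw [List.nodup_cons, List.nodup_append]
        refine ⟨?_, h1, by simp, ?_⟩
        · intro h
          rcases List.mem_append.1 h with h | h
          · exact (hFm u (h3 u h)).2.1 rfl
          · simp at h; exact huv h
        · intro a ha b hb
          simp at hb
          subst hb
          exact (hFm a (h3 a ha)).2.2
      · rw [List.isChain_cons, List.isChain_append]
        refine ⟨?_, h2, by simp, ?_⟩
        · intro a ha
          have := List.mem_of_mem_head? ha
          rcases List.mem_append.1 this with h | h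
          · exact hu a (hFm a (h3 a h)).1 (hFm a (h3 a h)).2.1
          · simp at h; subst h; exact hI.adj
        · intro a ha b hb
          simp at hb
          subst hb
          have := h3 a (List.mem_of_mem_getLast? ha)
          exact (hv a (hFm a this).1 (hFm a this).2.2).symm
      · intro a ha
        simp only [List.mem_cons, List.mem_append, List.not_mem_nil, or_false] at ha
        rcases ha with rfl | ha | rfl
        · exact hI.hu
        · exact (hFm a (h3 a ha)).1
        · exact hI.hv
      · rw [← List.cons_append, List.getLast?_append]; simp
  have w1 := W_remove (G := G) (s := s) (c := 0) (by omega) hI.hu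
  have w2 := W_remove (G := G) (s := s) (c := 0 + 1) (by omega) hvu
  have w3 := EG (G := G) (s := s) (by omega) hm 2 F hPB
  have hc1 := card_erase_add_one hI.hu
  have hc2 := card_erase_add_one hvu
  rw [← hF] at hc2 w2
  rw [show F.card = S.card - 2 by omega] at w3
  have : PS (fun i => Nat.choose i (s - 1)) 2 = Nat.choose 0 (s-1) + Nat.choose (0+1) (s-1) := by
    simp [PS, sum_range_succ]
  rw [this]
  simp only [zero_add] at w1 w2 ⊢
  norm_num at w2
  omega

theorem PS_choose {s : ℕ} (hs : 1 ≤ s) (j : ℕ) :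
    PS (fun i => Nat.choose (2 + i) (s - 1)) j + Nat.choose 2 s = Nat.choose (j + 2) s := by
  induction j with
  | zero => simp [PS]
  | succ j ih =>
    rw [PS_succ]
    obtain ⟨s, rfl⟩ := Nat.exists_eq_add_of_le hs
    rw [show j + 1 + 2 = (j + 2) + 1 by omega, show 1 + s = s + 1 by omega, Nat.choose_succ_succ' (j+2) s]
    rw [show 1 + s = s + 1 by omega] at ih
    simp only [Nat.add_sub_cancel] at ih ⊢
    rw [add_comm 2 j]
    omega

theorem walk_of_chain (l : List V) (u v : V) (h : (u :: l).IsChain G.Adj)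
    (hv : (u :: l).getLast? = some v) : ∃ w : G.Walk u v, w.support = u :: l := by
  induction l generalizing u with
  | nil =>
    simp at hv
    subst hv
    exact ⟨.nil, rfl⟩
  | cons a l ih =>
    rw [List.isChain_cons_cons] at h
    obtain ⟨w, hw⟩ := ih a h.2 (by simpa using hv)
    exact ⟨.cons h.1 w, by simp [hw]⟩

theorem final {V : Type*} [Fintype V] (G : SimpleGraph V) (u v : V)
    (k s r t : ℕ) (hk : 4 ≤ k) (hs : 2 ≤ s)
    (h2c : ∀ v : V, (G.induce {w : V | w ≠ v}).Connected) (huv : G.Adj u v)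
    (ht : t ≤ k - 4) (hrt : Fintype.card V - 2 = r * (k - 3) + t)
    (hcyc : ∀ (a : V) (w : G.Walk a a), w.IsCycle → s(u, v) ∈ w.edges → w.length < k) :
    (G.cliqueSet s).ncard ≤ r * Nat.choose (k - 1) s + Nat.choose (t + 2) s := by
  classical
  have hI : Inv G univ u v ((k - 3) + 2) := by
    refine ⟨huv, mem_univ _, mem_univ _, ?_, ?_⟩
    · intro w _ A hA hne hneq
      obtain ⟨a, ha⟩ := hne
      obtain ⟨b, hb, hbA⟩ := not_subset.1 (fun h => hneq (hA.antisymm h))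
      have hb' : b ≠ w := ne_of_mem_erase hb
      have ha' : a ≠ w := ne_of_mem_erase (hA ha)
      obtain ⟨p⟩ := (h2c w).preconnected ⟨a, ha'⟩ ⟨b, hb'⟩
      obtain ⟨d, -, h1, h2⟩ := p.exists_boundary_dart {z | (z : V) ∈ A} ha hbA
      exact ⟨d.fst, h1, d.snd, mem_erase.2 ⟨d.snd.2, mem_univ _⟩, h2, d.adj⟩
    · intro l h1 h2 h3 h4 h5
      by_contra hlen
      cases l with
      | nil => simp at h4
      | cons a l =>
        simp at h4
        subst h4
        obtain ⟨w, hw⟩ := walk_of_chain l a v h2 h5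
        have hwp : w.IsPath := by
          rw [SimpleGraph.Walk.isPath_def, hw]; exact h1
        have hwl : w.length + 1 = l.length + 1 := by
          rw [← SimpleGraph.Walk.length_support, hw]; simp
        simp at hlen
        have := hcyc v (.cons huv.symm w) ?_ ?_
        · simp at this; omega
        · rw [SimpleGraph.Walk.cons_isCycle_iff]
          refine ⟨hwp, ?_⟩
          intro he
          cases w with
          | nil => exact huv.ne rfl
          | @cons _ c _ h p =>
            rw [SimpleGraph.Walk.cons_isPath_iff] at hwp
            rw [SimpleGraph.Walk.edges_cons, List.mem_cons] at he
            rcases he with he | he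
            · have hc : v = c := by
                rcases Sym2.eq_iff.1 he with ⟨e1, e2⟩ | ⟨e1, e2⟩
                · exact absurd e1.symm huv.ne
                · exact e1
              subst hc
              have := SimpleGraph.Walk.nil_iff_eq_nil.1 (SimpleGraph.Walk.isPath_iff_nil.1 hwp.1)
              subst this
              simp at hwl
              omega
            · exact hwp.2 (SimpleGraph.Walk.snd_mem_support_of_mem_edges p he)
        · simp [Sym2.eq_swap]
  have h1 := claim hs (by omega) hI
  have h2 := W_zero (G := G) (s := s) (by omega)
  rw [card_univ, hrt, GB_eq _ (by omega : t < k - 3)] at h1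
  have h3 := PS_choose (s := s) (by omega) (k - 3)
  have h4 := PS_choose (s := s) (by omega) t
  rw [show k - 3 + 2 = k - 1 by omega] at h3
  have h5 : PS (fun i => Nat.choose i (s - 1)) 2 = Nat.choose 2 s := by
    obtain ⟨s, rfl⟩ := Nat.exists_eq_add_of_le hs
    rw [show 2 + s = s + 2 by omega]
    simp [PS, sum_range_succ, Nat.choose_succ_succ']
  rw [← h3, mul_add]
  omega

end Cliq


theorem stmt_13 {V : Type*} [Fintype V] (G : SimpleGraph V) (u v : V)
    (n k s r t : ℕ)
    (hn : Fintype.card V = n) (hn3 : 3 ≤ n) (hk : 4 ≤ k) (hs : 2 ≤ s)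
    (h2c : TwoConnected G) (huv : G.Adj u v)
    (ht : t ≤ k - 4) (hrt : n - 2 = r * (k - 3) + t)
    (hcyc : ∀ (a : V) (w : G.Walk a a), w.IsCycle → s(u, v) ∈ w.edges → w.length < k) :
    (G.cliqueSet s).ncard ≤ r * Nat.choose (k - 1) s + Nat.choose (t + 2) s := by
  subst hn
  exact Cliq.final G u v k s r t hk hs h2c.2 huv ht hrt hcyc
end
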